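/- arXiv:1309.6267 — 6 statements merged into one kernel-verified Lean document; each statement's English description precedes it below -/
import Mathlib

section
/- Suppose h belongs to ℛ (i.e. Case 1 or Case 2 holds) and q satisfies the corresponding tail condition. Then the moment generating function satisfies the Abelian asymptotic Φ(t) = √(2π) · σ̂ · exp(K(x̂, t)) · (1 + o(1)) as t → ∞, where x̂ = ψ(t), σ̂² = 1/h'(x̂) and K(x,t) = tx − g(x). -/
open Real Filter MeasureTheory Set ProbabilityTheory Asymptotics

noncomputable section

/-- `f` is regularly varying at infinity with index `α`: `f` is eventually positive and
`f (λ t) / f t → λ ^ α` as `t → ∞` for every `λ > 0`. -/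
def RegVary (α : ℝ) (f : ℝ → ℝ) : Prop :=
  (∀ᶠ x in atTop, 0 < f x) ∧
  ∀ lam : ℝ, 0 < lam →
    Tendsto (fun t => f (lam * t) / f t) atTop (nhds (lam ^ α))

/-- Case 1 (the regularly varying case) for the function `h = g'`:
`h x = c x^β exp (∫₁^x ε(u)/u du)` with `β > 0`, `c > 0`, `ε` twice differentiable with
`ε(x) → 0`, `x ε'(x) = O(1)`, `x² ε''(x) = O(1)`, and `|h''| ∈ RV(θ)` for some `θ ≤ β - 2`. -/
structure Case1 (h : ℝ → ℝ) (β c θ : ℝ) (ε : ℝ → ℝ) : Prop where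
  beta_pos : 0 < β
  c_pos : 0 < c
  h_eq : ∀ x ≥ (1:ℝ), h x = c * x ^ β * Real.exp (∫ u in (1:ℝ)..x, ε u / u)
  eps_diff : ∀ x ≥ (1:ℝ), DifferentiableAt ℝ ε x
  eps_diff2 : ∀ x ≥ (1:ℝ), DifferentiableAt ℝ (deriv ε) x
  eps_to_zero : Tendsto ε atTop (nhds 0)
  eps_deriv_bigO : (fun x => x * deriv ε x) =O[atTop] (fun _ => (1:ℝ))
  eps_deriv2_bigO : (fun x => x ^ 2 * deriv (deriv ε) x) =O[atTop] (fun _ => (1:ℝ))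
  h2_RV : RegVary θ (fun x => |deriv (deriv h) x|)
  theta_le : θ ≤ β - 2

/-- Case 2 (the rapidly varying case), stated through `ψ = h⁻¹`:
`ψ t = c exp (∫₁^t ε(u)/u du)` with `c > 0`, `ε` twice differentiable with `ε(t) → 0`,
`t ε'(t)/ε(t) → 0` and `t² ε''(t)/ε(t) → 0`. -/
structure Case2 (ψ : ℝ → ℝ) (c : ℝ) (ε : ℝ → ℝ) : Prop where
  c_pos : 0 < c
  psi_eq : ∀ t ≥ (1:ℝ), ψ t = c * Real.exp (∫ u in (1:ℝ)..t, ε u / u)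
  eps_diff : ∀ t ≥ (1:ℝ), DifferentiableAt ℝ ε t
  eps_diff2 : ∀ t ≥ (1:ℝ), DifferentiableAt ℝ (deriv ε) t
  eps_to_zero : Tendsto ε atTop (nhds 0)
  eps_ratio1 : Tendsto (fun t => t * deriv ε t / ε t) atTop (nhds 0)
  eps_ratio2 : Tendsto (fun t => t ^ 2 * deriv (deriv ε) t / ε t) atTop (nhds 0)

/-- A differentiable function whose derivative tends to zero grows sublinearly. -/
theorem tendsto_div_self_of_deriv_tendsto_zero {s s' : ℝ → ℝ}
    (hs : ∀ᶠ x in atTop, HasDerivAt s (s' x) x) (hs' : Tendsto s' atTop (nhds 0)) :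
    Tendsto (fun x => s x / x) atTop (nhds 0) := by
  rw [Metric.tendsto_nhds]
  intro δ hδ
  have h1 : ∀ᶠ x in atTop, ‖s' x‖ < δ / 2 := by
    simpa [dist_eq_norm] using (Metric.tendsto_nhds.1 hs') (δ / 2) (by positivity)
  obtain ⟨a, ha⟩ := eventually_atTop.1 (hs.and h1)
  have h2 : ∀ᶠ x in atTop, |s a| + δ / 2 * |a| < δ / 2 * x :=
    (tendsto_id.const_mul_atTop (by positivity : 0 < δ / 2)).eventually_gt_atTop _
  filter_upwards [eventually_ge_atTop a, eventually_gt_atTop 0, h2] with x hxa hx0 hx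
  have h3 : ‖s x - s a‖ ≤ δ / 2 * ‖x - a‖ :=
    (convex_Ici a).norm_image_sub_le_of_norm_hasDerivWithin_le
      (fun y hy => (ha y hy).1.hasDerivWithinAt) (fun y hy => (ha y hy).2.le)
      self_mem_Ici hxa
  rw [Real.norm_eq_abs, Real.norm_eq_abs, abs_of_nonneg (sub_nonneg.2 hxa)] at h3
  rw [Real.dist_eq, sub_zero, abs_div, abs_of_pos hx0, div_lt_iff₀ hx0]
  have h4 := abs_sub_abs_le_abs_sub (s x) (s a)
  nlinarith [neg_abs_le a]

/-- A positive function whose derivative tends to zero is self-neglecting, locally uniformly. -/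
theorem eventually_abs_div_sub_one_le_of_deriv_tendsto_zero {s s' : ℝ → ℝ}
    (hs : ∀ᶠ x in atTop, HasDerivAt s (s' x) x) (hs' : Tendsto s' atTop (nhds 0))
    (hpos : ∀ᶠ x in atTop, 0 < s x) {Y δ : ℝ} (hY : 0 < Y) (hδ : 0 < δ) :
    ∀ᶠ x in atTop, ∀ ξ, |ξ - x| ≤ Y * s x → |s ξ / s x - 1| ≤ δ := by
  have h1 : ∀ᶠ x in atTop, ‖s' x‖ < δ / Y := by
    simpa [dist_eq_norm] using (Metric.tendsto_nhds.1 hs') (δ / Y) (by positivity)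
  obtain ⟨a, ha⟩ := eventually_atTop.1 (hs.and h1)
  have h2 : ∀ᶠ x in atTop, s x / x < 1 / (2 * Y) :=
    (tendsto_div_self_of_deriv_tendsto_zero hs hs').eventually_lt_const (by positivity)
  filter_upwards [eventually_ge_atTop (2 * a), eventually_gt_atTop 0, eventually_ge_atTop a, h2,
    hpos] with x hx2a hx0 hxa hx hsx ξ hξ
  have h3 : Y * s x ≤ x / 2 := by
    rw [div_lt_iff₀ hx0] at hx
    calc Y * s x ≤ Y * (1 / (2 * Y) * x) := by gcongr
      _ = x / 2 := by field_simp
  have h4 : a ≤ ξ := by linarith [(abs_le.1 hξ).1]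
  have h5 : ‖s ξ - s x‖ ≤ δ / Y * ‖ξ - x‖ :=
    (convex_Ici a).norm_image_sub_le_of_norm_hasDerivWithin_le
      (fun y hy => (ha y hy).1.hasDerivWithinAt) (fun y hy => (ha y hy).2.le) hxa h4
  rw [Real.norm_eq_abs, Real.norm_eq_abs] at h5
  rw [div_sub_one hsx.ne', abs_div, abs_of_pos hsx, div_le_iff₀ hsx]
  calc _ ≤ _ := h5
    _ ≤ δ / Y * (Y * s x) := by gcongr
    _ = δ * s x := by field_simp

/-- If `f'' - 1` is small near the origin and `f`, `f'` vanish there, then `f` is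
quadratically close to `y ^ 2 / 2`. -/
theorem abs_sub_sq_div_two_le {f f' f'' : ℝ → ℝ} {Y δ : ℝ}
    (hf : ∀ y, |y| ≤ Y → HasDerivAt f (f' y) y) (hf' : ∀ y, |y| ≤ Y → HasDerivAt f' (f'' y) y)
    (hf'' : ∀ y, |y| ≤ Y → |f'' y - 1| ≤ δ) (h0 : f 0 = 0) (h0' : f' 0 = 0) {y : ℝ}
    (hy : |y| ≤ Y) : |f y - y ^ 2 / 2| ≤ δ * y ^ 2 := by
  have hball : ∀ {z r : ℝ}, z ∈ Icc (-r) r ↔ |z| ≤ r := fun {z r} => by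
    rw [abs_le, mem_Icc]
  have hδ : 0 ≤ δ := (abs_nonneg _).trans (hf'' y hy)
  have hb : ∀ z, |z| ≤ Y → |f' z - z| ≤ δ * |z| := by
    intro z hz
    have := (convex_Icc (-Y) Y).norm_image_sub_le_of_norm_hasDerivWithin_le
      (f := fun z => f' z - z) (f' := fun z => f'' z - 1) (C := δ) (x := 0) (y := z)
      (fun w hw => ((hf' w (hball.1 hw)).sub (hasDerivAt_id w)).hasDerivWithinAt)
      (fun w hw => hf'' w (hball.1 hw)) (hball.2 (by simpa using (abs_nonneg z).trans hz))
      (hball.2 hz)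
    simpa [h0'] using this
  have := (convex_Icc (-|y|) |y|).norm_image_sub_le_of_norm_hasDerivWithin_le
      (f := fun z => f z - z ^ 2 / 2) (f' := fun z => f' z - z) (C := δ * |y|) (x := 0) (y := y)
      (fun w hw => by
        have h1 := (hf w ((hball.1 hw).trans hy)).sub (((hasDerivAt_id w).pow 2).div_const 2)
        refine (h1.congr_deriv ?_).hasDerivWithinAt
        simp)
      (fun w hw => (hb w ((hball.1 hw).trans hy)).trans
        (mul_le_mul_of_nonneg_left (hball.1 hw) hδ))
      (hball.2 (by simp)) (hball.2 le_rfl)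
  simp only [h0, Real.norm_eq_abs] at this
  calc |f y - y ^ 2 / 2| ≤ δ * |y| * |y| := by simpa using this
    _ = δ * y ^ 2 := by rw [mul_assoc, abs_mul_abs_self, sq]

/-- A convex function vanishing at the origin and at least `c` at `±1` dominates `c * |y|`
outside the unit interval. -/
theorem mul_abs_le_of_convexOn {f : ℝ → ℝ} {S : Set ℝ} (hf : ConvexOn ℝ S f) (hS : (0:ℝ) ∈ S)
    {c : ℝ} (h0 : f 0 = 0) (h1 : c ≤ f 1) (h1' : c ≤ f (-1)) {y : ℝ} (hyS : y ∈ S)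
    (hy : 1 ≤ |y|) : c * |y| ≤ f y := by
  have hy0 : 0 < |y| := by linarith
  have key := hf.2 hyS hS (inv_nonneg.2 hy0.le)
    (sub_nonneg.2 (inv_le_one_of_one_le₀ hy)) (add_sub_cancel _ _)
  simp only [smul_eq_mul, h0, mul_zero, add_zero] at key
  have hc : c ≤ f (|y|⁻¹ * y) := by
    rcases abs_choice y with h | h
    · have hne : y ≠ 0 := fun h' => by simp [h'] at hy0
      rwa [h, inv_mul_cancel₀ hne]
    · have hne : y ≠ 0 := fun h' => by simp [h'] at hy0
      rwa [h, inv_neg, neg_mul, inv_mul_cancel₀ hne]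
  have := hc.trans key
  rwa [inv_mul_eq_div, le_div_iff₀ hy0] at this

/-- The scale `1 / √h'` is self-neglecting as soon as `h''² / h'³` tends to zero. -/
theorem eventually_abs_deriv_div_sub_one_le {h1 h2 : ℝ → ℝ}
    (hh1 : ∀ x > 0, HasDerivAt h1 (h2 x) x) (hpos : ∀ᶠ x in atTop, 0 < h1 x)
    (hlim : Tendsto (fun x => h2 x ^ 2 / h1 x ^ 3) atTop (nhds 0)) :
    Tendsto (fun x => √(1 / h1 x) / x) atTop (nhds 0) ∧
    ∀ Y > 0, ∀ δ > 0, ∀ᶠ x in atTop, ∀ ξ, |ξ - x| ≤ Y * √(1 / h1 x) →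
      |√(1 / h1 x) ^ 2 * h1 ξ - 1| ≤ δ := by
  set s : ℝ → ℝ := fun x => √(1 / h1 x)
  set s' : ℝ → ℝ := fun x => (-h2 x / h1 x ^ 2) / (2 * √(1 / h1 x))
  have hs : ∀ᶠ x in atTop, HasDerivAt s (s' x) x := by
    filter_upwards [hpos, eventually_gt_atTop 0] with x hx hx0
    have := ((hh1 x hx0).fun_inv hx.ne').sqrt (inv_pos.2 hx).ne'
    simpa [s, s'] using this
  have hs' : Tendsto s' atTop (nhds 0) := by
    have h3 : Tendsto (fun x => √(h2 x ^ 2 / h1 x ^ 3 / 4)) atTop (nhds 0) := by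
      simpa using (hlim.div_const 4).sqrt
    rw [tendsto_zero_iff_abs_tendsto_zero]
    refine h3.congr' ?_
    filter_upwards [hpos] with x hx
    rw [Function.comp_apply, ← Real.sqrt_sq_eq_abs]
    congr 1
    simp only [s', div_pow, mul_pow, Real.sq_sqrt (one_div_pos.2 hx).le]
    field_simp
    norm_num
  have hspos : ∀ᶠ x in atTop, 0 < s x := by
    filter_upwards [hpos] with x hx using Real.sqrt_pos.2 (one_div_pos.2 hx)
  have hsx := tendsto_div_self_of_deriv_tendsto_zero hs hs'
  refine ⟨hsx, fun Y hY δ hδ => ?_⟩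
  have hcont : ContinuousAt (fun r : ℝ => (r ^ 2)⁻¹) 1 :=
    (continuousAt_id.pow 2).inv₀ (by simp)
  obtain ⟨δ', hδ', hcl⟩ := Metric.continuousAt_iff.1 hcont δ hδ
  obtain ⟨a, ha⟩ := eventually_atTop.1 hpos
  filter_upwards [hpos, eventually_gt_atTop 0, eventually_ge_atTop (2 * a),
    hsx.eventually_lt_const (by positivity : 0 < 1 / (2 * Y)),
    eventually_abs_div_sub_one_le_of_deriv_tendsto_zero hs hs' hspos hY (half_pos hδ')]
    with x hx hx0 hx2a hsmall hself ξ hξ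
  have h3 : Y * s x ≤ x / 2 := by
    rw [div_lt_iff₀ hx0] at hsmall
    calc Y * s x ≤ Y * (1 / (2 * Y) * x) := by gcongr
      _ = x / 2 := by field_simp
  have hξpos : 0 < h1 ξ := ha ξ (by linarith [(abs_le.1 hξ).1])
  have := hcl (x := s ξ / s x) (by
    rw [Real.dist_eq]; exact (hself ξ hξ).trans_lt (by linarith))
  rw [Real.dist_eq] at this
  simp only [s, div_pow, Real.sq_sqrt (one_div_pos.2 hx).le,
    Real.sq_sqrt (one_div_pos.2 hξpos).le, one_pow, inv_one] at this
  rw [Real.sq_sqrt (one_div_pos.2 hx).le]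
  refine le_of_eq_of_le ?_ this.le
  congr 2
  field_simp

/-- Second-order expansion of `g` on the scale `1 / √h'`. -/
theorem eventually_abs_expansion_le {g h h1 h2 : ℝ → ℝ}
    (hg : ∀ x > 0, HasDerivAt g (h x) x) (hh : ∀ x > 0, HasDerivAt h (h1 x) x)
    (hh1 : ∀ x > 0, HasDerivAt h1 (h2 x) x) (hpos : ∀ᶠ x in atTop, 0 < h1 x)
    (hlim : Tendsto (fun x => h2 x ^ 2 / h1 x ^ 3) atTop (nhds 0)) {Y δ : ℝ} (hY : 0 < Y)
    (hδ : 0 < δ) :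
    ∀ᶠ x in atTop, ∀ y, |y| ≤ Y →
      0 < x + √(1 / h1 x) * y ∧
      |(g (x + √(1 / h1 x) * y) - g x - h x * (√(1 / h1 x) * y)) - y ^ 2 / 2| ≤ δ * y ^ 2 := by
  obtain ⟨hsx, hloc⟩ := eventually_abs_deriv_div_sub_one_le hh1 hpos hlim
  filter_upwards [hpos, eventually_gt_atTop 0,
    hsx.eventually_lt_const (by positivity : 0 < 1 / Y), hloc Y hY δ hδ]
    with x hx hx0 hsmall hl
  set s := √(1 / h1 x)
  have hs : 0 ≤ s := Real.sqrt_nonneg _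
  have h3 : Y * s < x := by
    rw [div_lt_iff₀ hx0] at hsmall
    calc Y * s < Y * (1 / Y * x) := by gcongr
      _ = x := by field_simp
  have habs : ∀ y, |y| ≤ Y → |s * y| ≤ Y * s := fun y hy => by
    rw [abs_mul, abs_of_nonneg hs, mul_comm]; gcongr
  have hdom : ∀ y, |y| ≤ Y → 0 < x + s * y := fun y hy => by
    linarith [(abs_le.1 (habs y hy)).1]
  have hlin : ∀ y, HasDerivAt (fun y => x + s * y) s y := fun y => by
    simpa using ((hasDerivAt_id y).const_mul s).const_add x
  intro y hy
  refine ⟨hdom y hy, ?_⟩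
  refine abs_sub_sq_div_two_le (Y := Y)
    (f := fun y => g (x + s * y) - g x - h x * (s * y))
    (f' := fun y => h (x + s * y) * s - h x * s) (f'' := fun y => s ^ 2 * h1 (x + s * y))
    (fun y hy => ?_) (fun y hy => ?_) (fun y hy => hl _ ?_) (by simp) (by simp) hy
  · have h4 := (((hg _ (hdom y hy)).comp y (hlin y)).sub_const (g x)).sub
      (((hasDerivAt_id y).const_mul s).const_mul (h x))
    exact h4.congr_deriv (by simp)
  · have h4 := (((hh _ (hdom y hy)).comp y (hlin y)).mul_const s).sub_const (h x * s)
    exact h4.congr_deriv (by ring)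
  · simpa using habs y hy

/-- Laplace asymptotics of a log-convex weight perturbed by a bounded vanishing exponent. -/
theorem tendsto_laplace_integral {g h h1 h2 q p : ℝ → ℝ} (hconv : ConvexOn ℝ (Ioi 0) g)
    (hg : ∀ x > 0, HasDerivAt g (h x) x) (hh : ∀ x > 0, HasDerivAt h (h1 x) x)
    (hh1 : ∀ x > 0, HasDerivAt h1 (h2 x) x) (hpos : ∀ᶠ x in atTop, 0 < h1 x)
    (hlim : Tendsto (fun x => h2 x ^ 2 / h1 x ^ 3) atTop (nhds 0))
    (hh_top : Tendsto h atTop atTop) (hq_bdd : ∃ M : ℝ, ∀ x ≥ (0:ℝ), |q x| ≤ M)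
    (hq : Tendsto q atTop (nhds 0))
    (hp : ∀ x, p x = if 0 ≤ x then Real.exp (-(g x - q x)) else 0)
    (hint : ∀ t > (0:ℝ), Integrable (fun x => Real.exp (t * x) * p x)) :
    Tendsto (fun x => (∫ z, Real.exp (h x * z) * p z) /
      (√(2 * π) * √(1 / h1 x) * Real.exp (h x * x - g x))) atTop (nhds 1) := by
  obtain ⟨M, hM⟩ := hq_bdd
  obtain ⟨hsx, -⟩ := eventually_abs_deriv_div_sub_one_le hh1 hpos hlim
  set s : ℝ → ℝ := fun x => √(1 / h1 x)
  have hspos : ∀ᶠ x in atTop, 0 < s x := by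
    filter_upwards [hpos] with x hx using Real.sqrt_pos.2 (one_div_pos.2 hx)
  set F : ℝ → ℝ → ℝ := fun x y =>
    Real.exp (-(h x * x - g x)) * (Real.exp (h x * (s x * y + x)) * p (s x * y + x)) with hF
  have hFval : ∀ x y, 0 ≤ x + s x * y → F x y =
      Real.exp (q (x + s x * y)) *
        Real.exp (-(g (x + s x * y) - g x - h x * (s x * y))) := by
    intro x y hxy
    simp only [hF]
    rw [add_comm (s x * y), hp, if_pos hxy, ← Real.exp_add, ← Real.exp_add, ← Real.exp_add]
    congr 1
    ring
  have hFzero : ∀ x y, x + s x * y < 0 → F x y = 0 := by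
    intro x y hxy
    simp only [hF]
    rw [add_comm (s x * y), hp, if_neg hxy.not_ge, mul_zero, mul_zero]
  have hgauss : ∫ y : ℝ, Real.exp (-(y ^ 2 / 2)) = √(2 * π) := by
    have := integral_gaussian (1 / 2)
    rw [show π / (1 / 2) = 2 * π by ring] at this
    rw [← this]
    congr 1
    ext y
    congr 1
    ring
  have hmain : Tendsto (fun x => ∫ y, F x y) atTop (nhds (√(2 * π))) := by
    rw [← hgauss]
    refine tendsto_integral_filter_of_dominated_convergence
      (fun y => Real.exp (|M| + 1 / 4) * Real.exp (-(1 / 4) * |y|)) ?_ ?_ ?_ ?_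
    · filter_upwards [hspos, hh_top.eventually_gt_atTop 0] with x hx hhx
      exact ((((hint _ hhx).comp_add_right x).comp_mul_left' hx.ne').const_mul _).1
    · filter_upwards [hspos, eventually_gt_atTop 0,
        eventually_abs_expansion_le hg hh hh1 hpos hlim one_pos (by norm_num : (0:ℝ) < 1 / 4)]
        with x hx hx0 hexp
      have hne : ∀ᵐ y : ℝ, y ≠ - x / s x := by
        simp [ae_iff]
      filter_upwards [hne] with y hy
      have hy0 : x + s x * y ≠ 0 := fun h0 => hy (by field_simp; linarith)
      rcases lt_or_gt_of_ne hy0 with hneg | hdom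
      · rw [hFzero x y hneg, norm_zero]; positivity
      rw [hFval x y hdom.le, norm_mul, Real.norm_eq_abs, Real.norm_eq_abs, Real.abs_exp,
        Real.abs_exp, ← Real.exp_add, ← Real.exp_add, Real.exp_le_exp]
      set k : ℝ → ℝ := fun y => g (x + s x * y) - g x - h x * (s x * y) with hk
      have hkconv : ConvexOn ℝ {y | 0 < x + s x * y} k := by
        have e : ∀ {a b u v : ℝ}, u + v = 1 →
            x + s x * (u * a + v * b) = u * (x + s x * a) + v * (x + s x * b) := by
          intro a b u v huv
          linear_combination -x * huv
        refine ⟨fun a ha b hb u v hu hv huv => ?_, fun a ha b hb u v hu hv huv => ?_⟩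
        · have := hconv.1 (x := x + s x * a) ha (y := x + s x * b) hb hu hv huv
          change 0 < x + s x * (u * a + v * b)
          rw [e huv]
          exact this
        · have := hconv.2 (x := x + s x * a) ha (y := x + s x * b) hb hu hv huv
          simp only [smul_eq_mul, hk, e huv] at this ⊢
          linear_combination this + g x * huv
      have hk1 := hexp 1 (by simp)
      have hk1' := hexp (-1) (by simp)
      have hklow : (|y| - 1) / 4 ≤ k y := by
        rcases le_total |y| 1 with hy1 | hy1
        · have := (abs_le.1 (hexp y hy1).2).1
          have h5 : 0 ≤ k y := by simp only [hk]; nlinarith [sq_nonneg y]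
          linarith
        · have := mul_abs_le_of_convexOn hkconv (c := 1 / 4) (by simpa using hx0) (by simp [hk])
            (by have := (abs_le.1 hk1.2).1; simp only [hk]; linarith)
            (by have := (abs_le.1 hk1'.2).1; simp only [hk]; linarith) hdom hy1
          linarith
      have hqM := (abs_le.1 (hM _ hdom.le)).2
      have := le_abs_self M
      change _ + -k y ≤ _
      linarith
    · refine Integrable.const_mul ?_ _
      rw [← integrableOn_univ, ← Iic_union_Ioi (a := (0:ℝ))]
      refine IntegrableOn.union ?_ ?_
      · refine (integrableOn_exp_mul_Iic (by norm_num : (0:ℝ) < 1 / 4) 0).congr_fun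
          (fun y hy => ?_) measurableSet_Iic
        simp only [abs_of_nonpos (mem_Iic.1 hy), neg_mul_neg]
      · refine (integrableOn_exp_mul_Ioi (by norm_num : -(1 / 4 : ℝ) < 0) 0).congr_fun
          (fun y hy => ?_) measurableSet_Ioi
        simp only [abs_of_pos (mem_Ioi.1 hy)]
    · refine Eventually.of_forall fun y => ?_
      have hz : Tendsto (fun x => x + s x * y) atTop atTop := by
        have h6 : Tendsto (fun x => x * (1 + s x / x * y)) atTop atTop := by
          refine tendsto_id.atTop_mul_pos one_pos ?_
          have := (hsx.mul_const y).const_add 1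
          rwa [zero_mul, add_zero] at this
        refine h6.congr' ?_
        filter_upwards [eventually_gt_atTop 0] with x hx
        field_simp
      have hky : Tendsto (fun x => g (x + s x * y) - g x - h x * (s x * y)) atTop
          (nhds (y ^ 2 / 2)) := by
        rw [Metric.tendsto_nhds]
        intro ε hε
        have hY : 0 < |y| + 1 := by positivity
        filter_upwards [eventually_abs_expansion_le hg hh hh1 hpos hlim hY
          (by positivity : 0 < ε / (y ^ 2 + 1))] with x hx
        rw [Real.dist_eq]
        refine (hx y (by linarith)).2.trans_lt ?_
        rw [div_mul_eq_mul_div, div_lt_iff₀ (by positivity)]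
        nlinarith
      have h7 : Tendsto (fun x => Real.exp (q (x + s x * y)) *
          Real.exp (-(g (x + s x * y) - g x - h x * (s x * y)))) atTop
          (nhds (Real.exp 0 * Real.exp (-(y ^ 2 / 2)))) :=
        ((Real.continuous_exp.tendsto _).comp (hq.comp hz)).mul
          ((Real.continuous_exp.tendsto _).comp hky.neg)
      rw [Real.exp_zero, one_mul] at h7
      refine h7.congr' ?_
      filter_upwards [hz.eventually_ge_atTop 0] with x hx
      exact (hFval x y hx).symm
  have h2π : √(2 * π) ≠ 0 := by positivity
  have hfin := hmain.div_const (√(2 * π))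
  rw [div_self h2π] at hfin
  refine hfin.congr' ?_
  filter_upwards [hspos] with x hx
  have e1 : ∫ y, F x y = Real.exp (-(h x * x - g x)) *
      ((s x)⁻¹ * ∫ z, Real.exp (h x * z) * p z) := by
    simp only [hF]
    rw [integral_const_mul, Measure.integral_comp_mul_left
      (fun z => Real.exp (h x * (z + x)) * p (z + x)) (s x),
      integral_add_right_eq_self (fun z => Real.exp (h x * z) * p z), abs_of_pos (inv_pos.2 hx),
      smul_eq_mul]
  rw [e1, Real.exp_neg]
  change _ = _ / (√(2 * π) * s x * _)
  field_simp

/-- A bounded function of negative index of regular variation vanishes at infinity. -/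
theorem RegVary.tendsto_zero {η M : ℝ} {f : ℝ → ℝ} (hf : RegVary η f) (hη : η < 0)
    (hM : ∀ᶠ x in atTop, f x ≤ M) : Tendsto f atTop (nhds 0) := by
  have hM' : ∀ᶠ x in atTop, f x ≤ |M| + 1 :=
    hM.mono fun x hx => hx.trans (by linarith [le_abs_self M])
  have hM0 : 0 < |M| + 1 := by positivity
  rw [Metric.tendsto_nhds]
  intro δ hδ
  have hpow : Tendsto (fun lam : ℝ => lam ^ η) atTop (nhds 0) := by
    simpa using tendsto_rpow_neg_atTop (neg_pos.2 hη)
  obtain ⟨lam, hlam, hlam0⟩ := ((hpow.eventually_lt_const (div_pos hδ hM0)).and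
    (eventually_gt_atTop 0)).exists
  have hdiv : Tendsto (fun x : ℝ => x / lam) atTop atTop := tendsto_id.atTop_div_const hlam0
  filter_upwards [hdiv.eventually ((hf.2 lam hlam0).eventually_lt_const hlam),
    hdiv.eventually hf.1, hdiv.eventually hM', hf.1] with x hx hx0 hxM hfx
  rw [mul_div_cancel₀ _ hlam0.ne', div_lt_iff₀ hx0] at hx
  rw [Real.dist_eq, sub_zero, abs_of_pos hfx]
  calc f x < δ / (|M| + 1) * f (x / lam) := hx
    _ ≤ δ / (|M| + 1) * (|M| + 1) := by gcongr
    _ = δ := by field_simp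

/-- Derivative of the integral in the Karamata representation. -/
theorem hasDerivAt_integral_div_self {ε : ℝ → ℝ} (hε : ∀ x ≥ (1:ℝ), DifferentiableAt ℝ ε x)
    {x : ℝ} (hx : 1 < x) : HasDerivAt (fun x => ∫ u in (1:ℝ)..x, ε u / u) (ε x / x) x := by
  have hc : ∀ u ≥ (1:ℝ), ContinuousAt (fun u => ε u / u) u := fun u hu =>
    (hε u hu).continuousAt.div continuousAt_id (zero_lt_one.trans_le hu).ne'
  refine intervalIntegral.integral_hasDerivAt_right ?_ ?_ (hc x hx.le)
  · refine ContinuousOn.intervalIntegrable fun u hu => (hc u ?_).continuousWithinAt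
    rw [uIcc_of_le hx.le] at hu
    exact hu.1
  · exact ContinuousOn.stronglyMeasurableAtFilter isOpen_Ioi
      (fun u hu => (hc u (le_of_lt hu)).continuousWithinAt) x hx

/-- In the regularly varying case `h' > 0` eventually and `h''² / h'³` vanishes at infinity. -/
theorem Case1.tendsto_sq_div_cube {h h1 h2 ε : ℝ → ℝ} {β c θ : ℝ} (H : Case1 h β c θ ε)
    (hh : ∀ x > 0, HasDerivAt h (h1 x) x) (hh1 : ∀ x > 0, HasDerivAt h1 (h2 x) x)
    (hh_top : Tendsto h atTop atTop) :
    (∀ᶠ x in atTop, 0 < h1 x) ∧ Tendsto (fun x => h2 x ^ 2 / h1 x ^ 3) atTop (nhds 0) := by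
  have e1 : ∀ x > 1, h1 x = h x * (β + ε x) / x := by
    intro x hx
    have hx0 : 0 < x := by linarith
    have hd := ((Real.hasDerivAt_rpow_const (p := β) (Or.inl hx0.ne')).const_mul c).mul
      (hasDerivAt_integral_div_self H.eps_diff hx).exp
    have heq : h =ᶠ[nhds x] fun x => c * x ^ β * Real.exp (∫ u in (1:ℝ)..x, ε u / u) := by
      filter_upwards [eventually_ge_nhds hx] with y hy using H.h_eq y hy
    rw [(hh x hx0).unique (hd.congr_of_eventuallyEq heq), H.h_eq x hx.le,
      Real.rpow_sub_one hx0.ne']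
    field_simp
  have e2 : ∀ x > 1, h2 x = h x / x ^ 2 * ((β + ε x) ^ 2 + x * deriv ε x - (β + ε x)) := by
    intro x hx
    have hx0 : 0 < x := by linarith
    have hd := ((hh x hx0).mul ((H.eps_diff x hx.le).hasDerivAt.const_add β)).div
      (hasDerivAt_id x) hx0.ne'
    have heq : h1 =ᶠ[nhds x] fun x => h x * (β + ε x) / x := by
      filter_upwards [eventually_gt_nhds hx] with y hy using e1 y hy
    rw [(hh1 x hx0).unique (hd.congr_of_eventuallyEq heq), e1 x hx]
    simp only [id, Pi.mul_apply]
    field_simp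
  have hr : Tendsto (fun x => β + ε x) atTop (nhds β) := by
    simpa using H.eps_to_zero.const_add β
  have hrpos : ∀ᶠ x in atTop, 0 < β + ε x := hr.eventually_const_lt H.beta_pos
  constructor
  · filter_upwards [hrpos, hh_top.eventually_gt_atTop 0, eventually_gt_atTop 1] with x hx hhx hx1
    rw [e1 x hx1]
    positivity
  have hxh : Tendsto (fun x => (x * h x)⁻¹) atTop (nhds 0) :=
    (tendsto_id.atTop_mul_atTop₀ hh_top).inv_tendsto_atTop
  have hnum : (fun x => (β + ε x) ^ 2 + x * deriv ε x - (β + ε x)) =O[atTop]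
      (fun _ => (1:ℝ)) :=
    (((hr.pow 2).isBigO_one ℝ).add H.eps_deriv_bigO).sub (hr.isBigO_one ℝ)
  have hden : (fun x => ((β + ε x) ^ 3)⁻¹) =O[atTop] (fun _ => (1:ℝ)) :=
    ((hr.pow 3).inv₀ (pow_pos H.beta_pos 3).ne').isBigO_one ℝ
  have hlo := ((hnum.pow 2).mul hden).mul_isLittleO ((isLittleO_one_iff ℝ).2 hxh)
  have hlim := (isLittleO_one_iff ℝ).1 (by simpa using hlo)
  refine hlim.congr' ?_
  filter_upwards [hrpos, hh_top.eventually_gt_atTop 0, eventually_gt_atTop 1] with x hx hhx hx1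
  rw [e1 x hx1, e2 x hx1]
  field_simp

/-- In the rapidly varying case `h' > 0` eventually and `h''² / h'³` vanishes at infinity. -/
theorem Case2.tendsto_sq_div_cube {h h1 h2 ψ ε : ℝ → ℝ} {c : ℝ} (H : Case2 ψ c ε)
    (hh : ∀ x > 0, HasDerivAt h (h1 x) x) (hh1 : ∀ x > 0, HasDerivAt h1 (h2 x) x)
    (hh_top : Tendsto h atTop atTop) (hnonneg : ∀ᶠ x in atTop, 0 ≤ h1 x)
    (hψ_inv : ∀ᶠ t in atTop, h (ψ t) = t) (hψ_inv' : ∀ᶠ x in atTop, ψ (h x) = x)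
    (hψ_top : Tendsto ψ atTop atTop) :
    (∀ᶠ x in atTop, 0 < h1 x) ∧ Tendsto (fun x => h2 x ^ 2 / h1 x ^ 3) atTop (nhds 0) := by
  have hψd : ∀ t > 1, HasDerivAt ψ (ψ t * ε t / t) t := by
    intro t ht
    have hd := (hasDerivAt_integral_div_self H.eps_diff ht).exp.const_mul c
    have heq : ψ =ᶠ[nhds t] fun t => c * Real.exp (∫ u in (1:ℝ)..t, ε u / u) := by
      filter_upwards [eventually_ge_nhds ht] with y hy using H.psi_eq y hy
    refine (hd.congr_of_eventuallyEq heq).congr_deriv ?_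
    rw [H.psi_eq t ht.le]
    ring
  have hψpos : ∀ t ≥ 1, 0 < ψ t := fun t ht => by
    rw [H.psi_eq t ht]
    exact mul_pos H.c_pos (Real.exp_pos _)
  have hinv1 : ∀ᶠ t in atTop, h1 (ψ t) * (ψ t * ε t / t) = 1 := by
    obtain ⟨T, hT⟩ := eventually_atTop.1 hψ_inv
    filter_upwards [eventually_gt_atTop T, eventually_gt_atTop 1] with t htT ht
    have hd := (hh _ (hψpos t ht.le)).comp t (hψd t ht)
    have heq : h ∘ ψ =ᶠ[nhds t] id := by
      filter_upwards [eventually_gt_nhds htT] with y hy using hT y hy.le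
    exact hd.unique ((hasDerivAt_id t).congr_of_eventuallyEq heq)
  have hεpos : ∀ᶠ t in atTop, 0 < ε t := by
    filter_upwards [hinv1, hψ_top.eventually hnonneg, eventually_ge_atTop 1] with t ht hn ht1
    by_contra! hneg
    have h3 : ψ t * ε t / t ≤ 0 :=
      div_nonpos_of_nonpos_of_nonneg (mul_nonpos_of_nonneg_of_nonpos (hψpos t ht1).le hneg)
        (by linarith)
    linarith [mul_nonpos_of_nonneg_of_nonpos hn h3]
  have e1 : ∀ᶠ t in atTop, h1 (ψ t) = t / (ψ t * ε t) := by
    filter_upwards [hinv1, hεpos, eventually_ge_atTop 1] with t ht hε ht1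
    have := hψpos t ht1
    field_simp at ht ⊢
    linarith
  have e2 : ∀ᶠ t in atTop,
      h2 (ψ t) = t / (ψ t * ε t) ^ 2 * (1 - ε t - t * deriv ε t / ε t) := by
    obtain ⟨T, hT⟩ := eventually_atTop.1 e1
    filter_upwards [eventually_gt_atTop T, eventually_gt_atTop 1, hεpos] with t htT ht hε
    have hψt := hψpos t ht.le
    have hd := (hh1 _ hψt).comp t (hψd t ht)
    have hd' := (hasDerivAt_id t).div ((hψd t ht).mul (H.eps_diff t ht.le).hasDerivAt)
      (mul_pos hψt hε).ne'
    have heq : h1 ∘ ψ =ᶠ[nhds t] fun t => t / (ψ t * ε t) := by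
      filter_upwards [eventually_gt_nhds htT] with y hy using hT y hy.le
    have hu := hd.unique (hd'.congr_of_eventuallyEq heq)
    simp only [id, Pi.mul_apply] at hu
    have hne : ψ t * ε t / t ≠ 0 := by positivity
    rw [← mul_left_inj' hne, hu]
    field_simp
    ring
  have htε : ∃ m > 0, ∀ᶠ t in atTop, m ≤ t * ε t := by
    obtain ⟨T, hT⟩ := eventually_atTop.1 ((hεpos.and (eventually_ge_atTop 1)).and
      (H.eps_ratio1.eventually_const_lt (show (-1:ℝ) < 0 by norm_num)))
    have hdT : ∀ t ≥ T, HasDerivAt (fun t => t * ε t) (1 * ε t + t * deriv ε t) t := fun t ht =>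
      (hasDerivAt_id t).mul (H.eps_diff t (hT t ht).1.2).hasDerivAt
    have hmono : MonotoneOn (fun t => t * ε t) (Ici T) := by
      refine monotoneOn_of_deriv_nonneg (convex_Ici T)
        (fun t ht => (hdT t ht).continuousAt.continuousWithinAt)
        (fun t ht => (hdT t (interior_subset ht)).differentiableAt.differentiableWithinAt)
        fun t ht => ?_
      have ht' : T ≤ t := interior_subset ht
      rw [(hdT t ht').deriv]
      have := (hT t ht').2
      rw [lt_div_iff₀ (hT t ht').1.1] at this
      linarith
    refine ⟨T * ε T, mul_pos (by linarith [(hT T le_rfl).1.2]) (hT T le_rfl).1.1, ?_⟩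
    filter_upwards [eventually_ge_atTop T] with t ht using hmono self_mem_Ici ht ht
  have hden : Tendsto (fun t => (t * ε t * ψ t)⁻¹) atTop (nhds 0) := by
    obtain ⟨m, hm, hmt⟩ := htε
    refine Tendsto.inv_tendsto_atTop (tendsto_atTop_mono' _ ?_ (hψ_top.const_mul_atTop hm))
    filter_upwards [hmt, eventually_ge_atTop 1] with t ht ht1
    exact mul_le_mul_of_nonneg_right ht (hψpos t ht1).le
  have hlim : Tendsto (fun t => h2 (ψ t) ^ 2 / h1 (ψ t) ^ 3) atTop (nhds 0) := by
    have hnum := ((H.eps_to_zero.const_sub 1).sub H.eps_ratio1).pow 2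
    have hprod := hnum.mul hden
    rw [mul_zero] at hprod
    refine hprod.congr' ?_
    filter_upwards [e1, e2, hεpos, eventually_ge_atTop 1] with t h3 h4 hε ht1
    have := hψpos t ht1
    rw [h3, h4]
    field_simp
  constructor
  · have hpos : ∀ᶠ t in atTop, 0 < h1 (ψ t) := by
      filter_upwards [e1, hεpos, eventually_ge_atTop 1] with t h3 hε ht1
      have := hψpos t ht1
      rw [h3]
      positivity
    filter_upwards [hh_top.eventually hpos, hψ_inv'] with x hx hx'
    rwa [hx'] at hx
  · refine (hlim.comp hh_top).congr' ?_
    filter_upwards [hψ_inv'] with x hx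
    simp only [Function.comp_apply, hx]

/-- the moment generating function satisfies the Abelian asymptotic
`Φ(t) = √(2π) σ̂ exp(K(x̂,t)) (1 + o(1))` as `t → ∞`, where `x̂ = ψ(t)`,
`σ̂² = 1/h'(x̂)` and `K(x,t) = tx − g(x)`. -/
theorem mgf_abelian_asymptotic
    (g ψ q p Φ : ℝ → ℝ)
    (hg_pos : ∀ x > (0:ℝ), 0 < g x)
    (hg_conv : ConvexOn ℝ (Set.Ioi 0) g)
    (hg_smooth : ContDiffOn ℝ 4 g (Set.Ioi 0))
    (hg_super : Tendsto (fun x => g x / x) atTop atTop)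
    (hh_mono : ∃ x₀ : ℝ, StrictMonoOn (deriv g) (Set.Ioi x₀))
    (hh_top : Tendsto (deriv g) atTop atTop)
    (hψ_inv : ∀ᶠ t in atTop, deriv g (ψ t) = t)
    (hψ_inv' : ∀ᶠ x in atTop, ψ (deriv g x) = x)
    (hψ_top : Tendsto ψ atTop atTop)
    (hq_meas : Measurable q)
    (hq_bdd : ∃ M : ℝ, ∀ x ≥ (0:ℝ), |q x| ≤ M)
    (hcase :
      (∃ β c θ ε, Case1 (deriv g) β c θ ε ∧
        ∃ η, η < θ - 3 * β / 2 - 3 / 2 ∧ RegVary η (fun x => |q x|)) ∨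
      (∃ c ε, Case2 ψ c ε ∧
        ∃ η, η < -(1/2 : ℝ) ∧ RegVary η (fun t => |q (ψ t)|)))
    (hp : ∀ x, p x = if 0 ≤ x then Real.exp (-(g x - q x)) else 0)
    (hΦ : ∀ t, Φ t = ∫ x, Real.exp (t * x) * p x)
    (hΦ_int : ∀ t > (0:ℝ), Integrable (fun x => Real.exp (t * x) * p x)) :
    Tendsto (fun t =>
        Φ t /
          (Real.sqrt (2 * Real.pi) * Real.sqrt (1 / deriv (deriv g) (ψ t)) *
            Real.exp (t * ψ t - g (ψ t))))
      atTop (nhds 1) := by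
  have hg1 : ContDiffOn ℝ 3 (deriv g) (Ioi 0) := hg_smooth.deriv_of_isOpen isOpen_Ioi (by norm_num)
  have hg2 : ContDiffOn ℝ 2 (deriv (deriv g)) (Ioi 0) :=
    hg1.deriv_of_isOpen isOpen_Ioi (by norm_num)
  have hasDeriv : ∀ {f : ℝ → ℝ} {n : WithTop ℕ∞}, ContDiffOn ℝ n f (Ioi 0) → n ≠ 0 →
      ∀ x > 0, HasDerivAt f (deriv f x) x := fun hf hn x hx =>
    ((hf.differentiableOn hn).differentiableAt (Ioi_mem_nhds hx)).hasDerivAt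
  have hd0 := hasDeriv hg_smooth (by norm_num)
  have hd1 := hasDeriv hg1 (by norm_num)
  have hd2 := hasDeriv hg2 (by norm_num)
  obtain ⟨M, hM⟩ := hq_bdd
  have hsecond : (∀ᶠ x in atTop, 0 < deriv (deriv g) x) ∧
      Tendsto (fun x => deriv (deriv (deriv g)) x ^ 2 / deriv (deriv g) x ^ 3) atTop (nhds 0) := by
    rcases hcase with ⟨β, c, θ, ε, H, -⟩ | ⟨c, ε, H, -⟩
    · exact H.tendsto_sq_div_cube hd1 hd2 hh_top
    · obtain ⟨x₀, hx₀⟩ := hh_mono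
      refine H.tendsto_sq_div_cube hd1 hd2 hh_top ?_ hψ_inv hψ_inv' hψ_top
      filter_upwards [eventually_gt_atTop x₀] with x hx
      rw [← derivWithin_of_isOpen isOpen_Ioi (mem_Ioi.2 hx)]
      exact hx₀.monotoneOn.derivWithin_nonneg
  have hq : Tendsto q atTop (nhds 0) := by
    rw [tendsto_zero_iff_abs_tendsto_zero]
    rcases hcase with ⟨β, c, θ, ε, H, η, hη, hR⟩ | ⟨c, ε, H, η, hη, hR⟩
    · refine hR.tendsto_zero (by linarith [H.beta_pos, H.theta_le]) (M := M) ?_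
      filter_upwards [eventually_ge_atTop 0] with x hx using hM x hx
    · have := hR.tendsto_zero (by linarith) (M := M) (by
        filter_upwards [hψ_top.eventually_ge_atTop 0] with t ht using hM _ ht)
      refine (this.comp hh_top).congr' ?_
      filter_upwards [hψ_inv'] with x hx
      simp only [Function.comp_apply, hx]
  have hmain := (tendsto_laplace_integral hg_conv hd0 hd1 hd2 hsecond.1 hsecond.2 hh_top ⟨M, hM⟩ hq
    hp hΦ_int).comp hψ_top
  refine hmain.congr' ?_
  filter_upwards [hψ_inv] with t ht
  simp only [Function.comp_apply, ht, hΦ]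
end
end

section
/- Let l be a measurable function, positive on a neighborhood of ∞, with l ∈ RV(α) for some α ∈ ℝ, and let f be a nonnegative function with f(t) = o(t) as t → ∞. Then sup_{|x| ≤ f(t)} l(t + x) ~ l(t) as t → ∞, i.e. the ratio sup_{|x| ≤ f(t)} l(t + x) / l(t) converges to 1. -/
open Real Filter MeasureTheory Set ProbabilityTheory Asymptotics

noncomputable section

/-- Uniform convergence theorem, additive form: a measurable function whose increments
`k (x + u) - k x` tend to `0` pointwise in `u` has uniformly small increments near infinity. -/
theorem eventually_abs_sub_lt_of_tendsto_increment {k : ℝ → ℝ} (hk : Measurable k)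
    (h : ∀ u, Tendsto (fun x => k (x + u) - k x) atTop (nhds 0)) {ε : ℝ} (hε : 0 < ε) :
    ∃ X : ℝ, ∀ x y, X ≤ x → x ≤ y → y ≤ x + 1 / 4 → |k y - k x| < ε := by
  set bad : ℝ → Set ℝ := fun x => {u | ε / 2 ≤ |k (x + u) - k x|} with hbad
  have hlim : Tendsto (fun x => (volume.restrict (Icc (0 : ℝ) 1)) (bad x)) atTop (nhds 0) := by
    refine tendsto_of_seq_tendsto fun x hx => ?_
    have hm : TendstoInMeasure (volume.restrict (Icc (0 : ℝ) 1))
        (fun n u => k (x n + u) - k (x n)) atTop (fun _ => (0 : ℝ)) := by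
      refine tendstoInMeasure_of_tendsto_ae (fun n => ?_) (ae_of_all _ fun u => (h u).comp hx)
      exact ((hk.comp (measurable_const_add _)).sub_const _).aestronglyMeasurable
    simpa [hbad, Function.comp_def] using
      (tendstoInMeasure_iff_norm.1 hm) (ε / 2) (half_pos hε)
  obtain ⟨X, hX⟩ := eventually_atTop.1
    (hlim.eventually (gt_mem_nhds (show (0 : ENNReal) < ENNReal.ofReal (1 / 4) by simp)))
  have hXb : ∀ x, X ≤ x → volume (bad x ∩ Icc 0 1) < ENNReal.ofReal (1 / 4) := fun x hx => by
    have := hX x hx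
    rwa [Measure.restrict_apply' measurableSet_Icc] at this
  refine ⟨X, fun x y hx hxy hy => ?_⟩
  have hex : ∃ u ∈ Icc (y - x) 1, u ∉ bad x ∧ u + (x - y) ∉ bad y := by
    by_contra! hcon
    have hsub : Icc (y - x) 1 ⊆
        (bad x ∩ Icc 0 1) ∪ (fun u => u + (x - y)) ⁻¹' (bad y ∩ Icc 0 1) := by
      intro u hu
      by_cases hb : u ∈ bad x
      · exact Or.inl ⟨hb, by linarith [hu.1], hu.2⟩
      · exact Or.inr ⟨hcon u hu hb, by linarith [hu.1], by linarith [hu.2]⟩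
    have hle := (measure_mono (μ := volume) hsub).trans (measure_union_le _ _)
    rw [measure_preimage_add_right, Real.volume_Icc] at hle
    have hlt := hle.trans_lt (ENNReal.add_lt_add (hXb x hx) (hXb y (hx.trans hxy)))
    rw [← ENNReal.ofReal_add (by norm_num) (by norm_num),
      ENNReal.ofReal_lt_ofReal_iff (by norm_num)] at hlt
    linarith
  obtain ⟨u, -, h1, h2⟩ := hex
  simp only [hbad, mem_ofPred_eq, not_le] at h1 h2
  rw [show y + (u + (x - y)) = x + u by ring] at h2
  rw [abs_lt] at *
  constructor <;> linarith [h1.1, h1.2, h2.1, h2.2]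

theorem RegVary.tendsto_log_increment {α : ℝ} {l : ℝ → ℝ} (hl : RegVary α l) (u : ℝ) :
    Tendsto (fun x => (log (l (exp (x + u))) - α * (x + u)) - (log (l (exp x)) - α * x))
      atTop (nhds 0) := by
  have h1 := ((hl.2 (exp u) (exp_pos u)).comp tendsto_exp_atTop).log
    (rpow_pos_of_pos (exp_pos u) α).ne'
  rw [log_rpow (exp_pos u), log_exp] at h1
  have h2 := h1.sub_const (α * u)
  rw [sub_self] at h2
  refine h2.congr' ?_
  have hp := tendsto_exp_atTop.eventually hl.1
  filter_upwards [hp, (tendsto_atTop_add_const_right _ u tendsto_id).eventually hp] with x hx hxu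
  simp only [id] at hxu
  rw [Function.comp_apply, ← exp_add, add_comm u x, log_div hxu.ne' hx.ne']
  ring

/-- Uniform convergence theorem near `1`: a measurable regularly varying function is
asymptotically constant, on the logarithmic scale, along multiplicatively close arguments. -/
theorem RegVary.exists_abs_log_sub_lt {α : ℝ} {l : ℝ → ℝ} (hl_meas : Measurable l)
    (hl : RegVary α l) {ε : ℝ} (hε : 0 < ε) :
    ∃ δ > 0, ∃ T > 0, ∀ s t, T ≤ s → T ≤ t → |log s - log t| < δ →
      |log (l s) - log (l t)| < ε := by
  have hk : Measurable fun x => log (l (exp x)) - α * x := by fun_prop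
  obtain ⟨X, hX⟩ := eventually_abs_sub_lt_of_tendsto_increment hk hl.tendsto_log_increment
    (half_pos hε)
  have hα : 0 < 2 * (|α| + 1) := by positivity
  refine ⟨min (1 / 4) (ε / (2 * (|α| + 1))), by positivity, exp X, exp_pos X, ?_⟩
  have key : ∀ s t, exp X ≤ s → s ≤ t →
      |log t - log s| < min (1 / 4) (ε / (2 * (|α| + 1))) →
      |log (l t) - log (l s)| < ε := by
    intro s t hs hst hd
    have hs0 := (exp_pos X).trans_le hs
    have hd1 := hd.trans_le (min_le_left _ _)
    have hd2 := hd.trans_le (min_le_right _ _)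
    rw [lt_div_iff₀ hα] at hd2
    have hlin : |α * (log t - log s)| ≤ ε / 2 := by
      rw [abs_mul]
      nlinarith [abs_nonneg (log t - log s)]
    have := hX (log s) (log t) ((le_log_iff_exp_le hs0).2 hs) (log_le_log hs0 hst)
      (by linarith [(abs_lt.1 hd1).2])
    rw [exp_log hs0, exp_log (hs0.trans_le hst)] at this
    rw [abs_lt] at *
    rw [abs_le] at hlin
    constructor <;> linarith [this.1, this.2, hlin.1, hlin.2]
  intro s t hs ht hd
  rcases le_total s t with hst | hst
  · rw [abs_sub_comm] at hd ⊢
    exact key s t hs hst hd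
  · exact key t s ht hst hd

theorem RegVary.eventually_le_mul {α : ℝ} {l : ℝ → ℝ} (hl_meas : Measurable l)
    (hl : RegVary α l) {f : ℝ → ℝ} (hf : f =o[atTop] (fun t => t)) {η : ℝ} (hη : 0 < η) :
    ∀ᶠ t in atTop, ∀ x ∈ Icc (-(f t)) (f t), l (t + x) ≤ (1 + η) * l t := by
  obtain ⟨δ, hδ, T, hT, hclose⟩ := hl.exists_abs_log_sub_lt hl_meas
    (log_pos (show 1 < 1 + η by linarith))
  obtain ⟨c, hc, hlog⟩ := Metric.continuousAt_iff.1 (continuousAt_log one_ne_zero) δ hδ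
  obtain ⟨P, hP⟩ := eventually_atTop.1 hl.1
  have hd : 0 < min (c / 2) (1 / 2) := by positivity
  filter_upwards [hf.def hd, eventually_ge_atTop (2 * T), eventually_ge_atTop (2 * P),
    eventually_ge_atTop P] with t hft htT htP htP' x hx
  have ht : 0 < t := by linarith
  rw [norm_of_nonneg ht.le] at hft
  have hxt : |x| ≤ min (c / 2) (1 / 2) * t :=
    (abs_le.2 hx).trans ((le_abs_self _).trans hft)
  have hx1 : |x| ≤ c / 2 * t := hxt.trans (by gcongr; exact min_le_left _ _)
  have hx2 : |x| ≤ 1 / 2 * t := hxt.trans (by gcongr; exact min_le_right _ _)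
  have hlow : t / 2 ≤ t + x := by linarith [(abs_le.1 hx2).1]
  have hpos : 0 < l (t + x) := hP _ (by linarith)
  have hpos' : 0 < l t := hP _ htP'
  have hratio : |log (t + x) - log t| < δ := by
    rw [← log_div (by linarith) ht.ne']
    have : dist ((t + x) / t) 1 < c := by
      rw [Real.dist_eq, add_div, div_self ht.ne', add_sub_cancel_left, abs_div, abs_of_pos ht,
        div_lt_iff₀ ht]
      nlinarith
    simpa [Real.dist_eq] using hlog this
  have := (abs_lt.1 (hclose _ _ (by linarith) (by linarith) hratio)).2
  rw [← log_le_log_iff hpos (by positivity), log_mul (by linarith) hpos'.ne']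
  linarith

/-- if `l ∈ RV(α)` and `f ≥ 0` with `f(t) = o(t)`, then
`sup_{|x| ≤ f(t)} l(t + x) ~ l(t)` as `t → ∞`. -/
theorem regvar_sup_equiv
    (α : ℝ) (l : ℝ → ℝ) (hl_meas : Measurable l) (hl : RegVary α l)
    (f : ℝ → ℝ) (hf_nonneg : ∀ t, 0 ≤ f t)
    (hf : f =o[atTop] (fun t => t)) :
    Tendsto (fun t =>
        sSup ((fun x => l (t + x)) '' Set.Icc (-(f t)) (f t)) / l t)
      atTop (nhds 1) := by
  rw [Metric.tendsto_nhds]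
  intro ε hε
  filter_upwards [hl.eventually_le_mul hl_meas hf (half_pos hε), hl.1] with t ht hpos
  have hub : ∀ b ∈ (fun x => l (t + x)) '' Icc (-(f t)) (f t), b ≤ (1 + ε / 2) * l t :=
    forall_mem_image.2 ht
  have hmem : l t ∈ (fun x => l (t + x)) '' Icc (-(f t)) (f t) :=
    ⟨0, ⟨by linarith [hf_nonneg t], hf_nonneg t⟩, by simp⟩
  have h1 := le_csSup ⟨_, hub⟩ hmem
  have h2 := csSup_le ⟨_, hmem⟩ hub
  rw [← one_le_div hpos] at h1
  rw [← div_le_iff₀ hpos] at h2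
  rw [Real.dist_eq, abs_lt]
  constructor <;> linarith
end
end

section
/- Let l be a measurable function, positive on a neighborhood of ∞, with l ∈ RV(α) for some α ≥ 0, and let 0 < a < 1. Then sup_{|x| ≤ at} l(t + x) ~ (1 + a)^α · l(t) as t → ∞, i.e. the ratio sup_{|x| ≤ at} l(t + x) / ((1+a)^α l(t)) converges to 1. -/
open Real Filter MeasureTheory Set ProbabilityTheory Asymptotics

noncomputable section

/-- The uniform convergence theorem in additive form: if `h` is measurable and
`h (x + u) - h x → 0` as `x → ∞` for every `u`, then the convergence is uniform for `|u| ≤ A`. -/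
theorem eventually_forall_abs_sub_lt_of_tendsto {h : ℝ → ℝ} (hm : Measurable h)
    (hlim : ∀ u : ℝ, Tendsto (fun x => h (x + u) - h x) atTop (nhds 0))
    {A δ : ℝ} (hA : 0 ≤ A) (hδ : 0 < δ) :
    ∀ᶠ x in atTop, ∀ v : ℝ, |v| ≤ A → |h (x + v) - h x| < δ := by
  let g : ℝ → ℝ → ℝ := fun x u => min 1 |h (x + u) - h x|
  have g_nonneg : ∀ x u, 0 ≤ g x u := fun x u => le_min zero_le_one (abs_nonneg _)
  have g_meas : ∀ x, Measurable (g x) := fun x => by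
    have h1 : Measurable fun u => h (x + u) - h x :=
      (hm.comp (measurable_const_add x)).sub_const _
    exact measurable_const.min h1.norm
  have g_norm : ∀ x u, ‖g x u‖ ≤ 1 := fun x u => by
    rw [Real.norm_of_nonneg (g_nonneg x u)]
    exact min_le_left _ _
  have g_int : ∀ x p q, IntervalIntegrable (g x) volume p q := fun x p q =>
    (intervalIntegrable_const (c := (1 : ℝ))).mono_fun (g_meas x).aestronglyMeasurable
      (Eventually.of_forall fun u => by simpa using g_norm x u)
  have hG : Tendsto (fun x => ∫ u in (-(A + 1))..(A + 1), g x u) atTop (nhds 0) := by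
    have h1 := intervalIntegral.tendsto_integral_filter_of_dominated_convergence
      (μ := volume) (a := -(A + 1)) (b := A + 1) (l := atTop) (F := g) (f := fun _ => (0 : ℝ))
      (fun _ => (1 : ℝ))
      (Eventually.of_forall fun x => (g_meas x).aestronglyMeasurable)
      (Eventually.of_forall fun x => Eventually.of_forall fun u _ => g_norm x u)
      intervalIntegrable_const
      (Eventually.of_forall fun u _ => by
        have h2 := (tendsto_const_nhds (x := (1 : ℝ))).min (hlim u).abs
        simpa using h2)
    simpa using h1
  have key : ∀ x v, |v| ≤ A → g x v ≤
      (∫ u in (-(A + 1))..(A + 1), g x u) + ∫ u in (-(A + 1))..(A + 1), g (x + v) u := by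
    intro x v hv
    obtain ⟨hv1, hv2⟩ := abs_le.1 hv
    have hshift : IntervalIntegrable (fun w => g (x + v) (w - v)) volume 0 1 := by
      have h1 := (g_int (x + v) (0 - v) (1 - v)).comp_sub_right v
      simpa using h1
    have h1 : g x v ≤ ∫ w in (0 : ℝ)..1, (g x w + g (x + v) (w - v)) := by
      have h2 : ∫ _ in (0 : ℝ)..1, g x v = g x v := by simp
      rw [← h2]
      refine intervalIntegral.integral_mono_on zero_le_one intervalIntegrable_const
        ((g_int x 0 1).add hshift) fun w _ => ?_
      have hw : x + v + (w - v) = x + w := by ring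
      simp only [g, hw]
      have htri := abs_sub_le (h (x + v)) (h (x + w)) (h x)
      rw [abs_sub_comm (h (x + v)) (h (x + w))] at htri
      have p1 := abs_nonneg (h (x + w) - h x)
      have p2 := abs_nonneg (h (x + w) - h (x + v))
      rcases min_cases 1 |h (x + w) - h x| with ⟨e1, _⟩ | ⟨e1, _⟩ <;>
      rcases min_cases 1 |h (x + w) - h (x + v)| with ⟨e2, _⟩ | ⟨e2, _⟩ <;>
      rcases min_cases 1 |h (x + v) - h x| with ⟨e3, _⟩ | ⟨e3, _⟩ <;>
      rw [e1, e2, e3] <;> linarith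
    rw [intervalIntegral.integral_add (g_int x 0 1) hshift,
      intervalIntegral.integral_comp_sub_right (g (x + v)) v] at h1
    have h3 : ∀ y p q, -(A + 1) ≤ p → p ≤ q → q ≤ A + 1 →
        ∫ w in p..q, g y w ≤ ∫ w in (-(A + 1))..(A + 1), g y w := fun y p q hp hpq hq =>
      intervalIntegral.integral_mono_interval hp hpq hq
        (Eventually.of_forall (g_nonneg y)) (g_int y _ _)
    have h4 := h3 x 0 1 (by linarith) zero_le_one (by linarith)
    have h5 := h3 (x + v) (0 - v) (1 - v) (by linarith) (by linarith) (by linarith)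
    linarith
  have hη : 0 < min 1 δ / 2 := by positivity
  obtain ⟨X, hX⟩ := eventually_atTop.1 (hG.eventually (gt_mem_nhds hη))
  filter_upwards [eventually_ge_atTop (X + A)] with x hx v hv
  have h1 := hX x (by linarith)
  have h2 := hX (x + v) (by linarith [(abs_le.1 hv).1])
  have h3 : g x v < min 1 δ := by linarith [key x v hv]
  rcases min_lt_iff.1 h3 with h4 | h4
  · exact absurd h4 (not_lt.2 (min_le_left _ _))
  · exact h4.trans_le (min_le_right _ _)

/-- Uniform upper bound for a measurable regularly varying function on compact sets of
multipliers. -/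
theorem RegVary.eventually_forall_le {α : ℝ} {l : ℝ → ℝ} (hl : RegVary α l)
    (hm : Measurable l) {b c d : ℝ} (hb : 1 < b) (hc : 0 < c) :
    ∀ᶠ t in atTop, ∀ s ∈ Icc c d, l (s * t) ≤ b * s ^ α * l t := by
  let h : ℝ → ℝ := fun y => Real.log (l (Real.exp y)) - α * y
  have h_meas : Measurable h :=
    (Real.measurable_log.comp (hm.comp Real.measurable_exp)).sub (measurable_id.const_mul α)
  have h_lim : ∀ u : ℝ, Tendsto (fun x => h (x + u) - h x) atTop (nhds 0) := by
    intro u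
    have hpow : (Real.exp u) ^ α ≠ 0 := (Real.rpow_pos_of_pos (Real.exp_pos u) α).ne'
    have h1 := (((hl.2 _ (Real.exp_pos u)).comp Real.tendsto_exp_atTop).log hpow).sub_const (α * u)
    rw [Real.log_rpow (Real.exp_pos u), Real.log_exp, sub_self] at h1
    refine h1.congr' ?_
    have hpos := Real.tendsto_exp_atTop.eventually hl.1
    have hpos' := (tendsto_atTop_add_const_right atTop u tendsto_id).eventually hpos
    filter_upwards [hpos, hpos'] with x hx hx'
    simp only [id] at hx'
    have hexp : Real.exp u * Real.exp x = Real.exp (x + u) := by rw [Real.exp_add, mul_comm]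
    simp only [h, Function.comp, hexp]
    rw [Real.log_div hx'.ne' hx.ne']
    ring
  obtain ⟨X, hX⟩ := eventually_atTop.1 hl.1
  have hA : 0 ≤ max |Real.log c| |Real.log d| := le_max_of_le_left (abs_nonneg _)
  have hunif := Real.tendsto_log_atTop.eventually
    (eventually_forall_abs_sub_lt_of_tendsto h_meas h_lim hA (Real.log_pos hb))
  filter_upwards [hunif, eventually_gt_atTop 0, eventually_ge_atTop X,
    eventually_ge_atTop (X / c)] with t ht ht0 htX htc s hs
  have hs0 : 0 < s := hc.trans_le hs.1
  have hlt : 0 < l t := hX t htX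
  have hlst : 0 < l (s * t) := by
    refine hX _ (((div_le_iff₀' hc).1 htc).trans ?_)
    gcongr
    exact hs.1
  have hv : |Real.log s| ≤ max |Real.log c| |Real.log d| :=
    abs_le_max_abs_abs (Real.log_le_log hc hs.1) (Real.log_le_log hs0 hs.2)
  have h1 := (abs_lt.1 (ht _ hv)).2
  have hexp : Real.exp (Real.log t + Real.log s) = s * t := by
    rw [Real.exp_add, Real.exp_log ht0, Real.exp_log hs0, mul_comm]
  simp only [h, hexp, Real.exp_log ht0] at h1
  have hpow : 0 < s ^ α := Real.rpow_pos_of_pos hs0 α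
  have hb0 : 0 < b := zero_lt_one.trans hb
  rw [← Real.log_le_log_iff hlst (by positivity), Real.log_mul (by positivity) hlt.ne',
    Real.log_mul hb0.ne' hpow.ne', Real.log_rpow hs0]
  linarith

/-- if `l ∈ RV(α)` with `α ≥ 0` and `0 < a < 1`, then
`sup_{|x| ≤ at} l(t + x) ~ (1 + a)^α l(t)` as `t → ∞`. -/
theorem regvar_sup_equiv_linear
    (α : ℝ) (hα : 0 ≤ α) (l : ℝ → ℝ) (hl_meas : Measurable l) (hl : RegVary α l)
    (a : ℝ) (ha : 0 < a) (ha1 : a < 1) :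
    Tendsto (fun t =>
        sSup ((fun x => l (t + x)) '' Set.Icc (-(a * t)) (a * t)) /
          ((1 + a) ^ α * l t))
      atTop (nhds 1) := by
  have hK : 0 < (1 + a) ^ α := Real.rpow_pos_of_pos (by linarith) α
  have upper : ∀ b : ℝ, 1 < b → ∀ᶠ t in atTop, ∀ y ∈
      (fun x => l (t + x)) '' Set.Icc (-(a * t)) (a * t), y ≤ b * ((1 + a) ^ α * l t) := by
    intro b hb
    filter_upwards [hl.eventually_forall_le hl_meas (d := 1 + a) hb (sub_pos.2 ha1),
      eventually_gt_atTop 0, hl.1] with t ht ht0 hlt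
    rintro _ ⟨x, ⟨hx1, hx2⟩, rfl⟩
    have hs1 : 1 - a ≤ 1 + x / t := by
      have : -a ≤ x / t := (le_div_iff₀ ht0).2 (by linarith)
      linarith
    have hs2 : 1 + x / t ≤ 1 + a := by
      have : x / t ≤ a := (div_le_iff₀ ht0).2 hx2
      linarith
    have hst : (1 + x / t) * t = t + x := by field_simp
    have h1 := ht _ ⟨hs1, hs2⟩
    rw [hst] at h1
    have h2 : (1 + x / t) ^ α ≤ (1 + a) ^ α :=
      Real.rpow_le_rpow (by linarith) hs2 hα
    calc l (t + x) ≤ b * (1 + x / t) ^ α * l t := h1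
      _ ≤ b * (1 + a) ^ α * l t := by gcongr
      _ = b * ((1 + a) ^ α * l t) := by ring
  have hlow : Tendsto (fun t => l ((1 + a) * t) / ((1 + a) ^ α * l t)) atTop (nhds 1) := by
    have h1 := (hl.2 (1 + a) (by linarith)).div_const ((1 + a) ^ α)
    rw [div_self hK.ne'] at h1
    refine h1.congr fun t => ?_
    rw [div_div, mul_comm (l t)]
  refine tendsto_order.2 ⟨fun b hb => ?_, fun b hb => ?_⟩
  · filter_upwards [hlow.eventually (lt_mem_nhds hb), upper 2 one_lt_two,
      eventually_gt_atTop 0, hl.1] with t ht hbdd ht0 hlt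
    refine ht.trans_le ?_
    gcongr
    have hat : 0 < a * t := by positivity
    exact le_csSup ⟨_, hbdd⟩ ⟨a * t, ⟨by linarith, le_rfl⟩, by ring_nf⟩
  · obtain ⟨b', hb1, hb2⟩ := exists_between hb
    filter_upwards [upper b' hb1, eventually_gt_atTop 0, hl.1] with t hbdd ht0 hlt
    refine lt_of_le_of_lt ((div_le_iff₀ (by positivity)).2 ?_) hb2
    have hat : 0 < a * t := by positivity
    exact csSup_le ((Set.nonempty_Icc.2 (by linarith)).image _) hbdd
end
end

section
/- Assume Case 1 (the regularly varying case) holds. Then h'(x) ~ β h(x)/x as x → ∞, and for each i ∈ {1, 2, 3} there is a constant Cᵢ > 0 such that |h^{(i)}(x)| ≤ Cᵢ h(x)/xⁱ for all sufficiently large x. -/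
open Real Filter MeasureTheory Set ProbabilityTheory Asymptotics

noncomputable section

/-- The logarithmic derivative of `c x^β exp (∫₁^x ε(u)/u du)` is `(β + ε x) / x`. -/
theorem Case1.hasDerivAt {h : ℝ → ℝ} {β c θ : ℝ} {ε : ℝ → ℝ} (H : Case1 h β c θ ε)
    {x : ℝ} (hx : 1 < x) : HasDerivAt h (h x * (β + ε x) / x) x := by
  have hx0 : 0 < x := by linarith
  have hcont : ContinuousOn (fun u => ε u / u) (Set.Ici 1) := fun u hu =>
    ((H.eps_diff u hu).continuousAt.div continuousAt_id
      (by have : (1:ℝ) ≤ u := hu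
          simp only [id]; linarith)).continuousWithinAt
  have hint : HasDerivAt (fun y => ∫ u in (1:ℝ)..y, ε u / u) (ε x / x) x := by
    refine intervalIntegral.integral_hasDerivAt_right ?_ ?_ ?_
    · refine (hcont.mono ?_).intervalIntegrable
      rw [Set.uIcc_of_le hx.le]
      exact Set.Icc_subset_Ici_self
    · exact (hcont.mono Set.Ioi_subset_Ici_self).stronglyMeasurableAtFilter isOpen_Ioi x hx
    · exact hcont.continuousAt (Ici_mem_nhds hx)
  have hpow : HasDerivAt (fun y : ℝ => c * y ^ β) (c * (β * x ^ (β - 1))) x :=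
    (Real.hasDerivAt_rpow_const (Or.inl hx0.ne')).const_mul c
  have heq : h =ᶠ[nhds x] fun y => c * y ^ β * Real.exp (∫ u in (1:ℝ)..y, ε u / u) := by
    filter_upwards [Ioi_mem_nhds hx] with y hy using H.h_eq y (le_of_lt hy)
  refine ((hpow.mul hint.exp).congr_of_eventuallyEq heq).congr_deriv ?_
  rw [H.h_eq x hx.le, Real.rpow_sub_one hx0.ne']
  field_simp

/-- If `h' = h p / x` and `F = h r / x^n` beyond `1`, then
`F' = h (p r + x r' - n r) / x^(n+1)` there. -/
theorem deriv_eq_of_eq_mul_div_pow {h p r r' F : ℝ → ℝ} {n : ℕ}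
    (hh : ∀ x, 1 < x → HasDerivAt h (h x * p x / x) x)
    (hF : ∀ x, 1 < x → F x = h x * r x / x ^ n)
    (hr : ∀ x, 1 < x → HasDerivAt r (r' x) x) :
    ∀ x, 1 < x → deriv F x = h x * (p x * r x + x * r' x - n * r x) / x ^ (n + 1) := by
  intro x hx
  have hx0 : x ≠ 0 := by linarith
  have heq : F =ᶠ[nhds x] fun y => h y * r y / y ^ n := by
    filter_upwards [Ioi_mem_nhds hx] with y hy using hF y hy
  refine heq.deriv_eq.trans
    ((((hh x hx).mul (hr x hx)).div (hasDerivAt_pow n x) (pow_ne_zero n hx0)).deriv.trans ?_)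
  rcases n with _ | n
  · simp only [pow_zero]
    field_simp
    simp
    ring
  · simp only [Nat.add_sub_cancel, Pi.mul_apply]
    field_simp
    ring

/-- A function of the form `h r / x^n` with `h` eventually positive and `r` bounded is
eventually bounded by a positive multiple of `h / x^n`. -/
theorem exists_abs_le_of_eq_mul_div_pow {h r F : ℝ → ℝ} {n : ℕ}
    (hpos : ∀ᶠ x in atTop, 0 < h x)
    (hF : ∀ x, 1 < x → F x = h x * r x / x ^ n)
    (hr : r =O[atTop] (fun _ => (1:ℝ))) :
    ∃ C > (0:ℝ), ∀ᶠ x in atTop, |F x| ≤ C * h x / x ^ n := by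
  obtain ⟨C, hC, hb⟩ := hr.exists_pos
  refine ⟨C, hC, ?_⟩
  filter_upwards [hpos, hb.bound, eventually_gt_atTop 1] with x hx hbx hx1
  have hx0 : 0 < x := by linarith
  rw [hF x hx1, abs_div, abs_mul, abs_of_pos hx, abs_of_pos (pow_pos hx0 n)]
  simp only [Real.norm_eq_abs, abs_one, mul_one] at hbx
  rw [mul_comm C]
  gcongr

/-- in Case 1, `h'(x) ~ β h(x)/x` as `x → ∞`, and for `i = 1, 2, 3` there is a
constant `Cᵢ > 0` with `|h^{(i)}(x)| ≤ Cᵢ h(x)/xⁱ` for all large `x` (here `h = g'`). -/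
theorem case1_deriv_bounds
    (g ψ : ℝ → ℝ) (β c θ : ℝ) (ε : ℝ → ℝ)
    (hg_pos : ∀ x > (0:ℝ), 0 < g x)
    (hg_conv : ConvexOn ℝ (Set.Ioi 0) g)
    (hg_smooth : ContDiffOn ℝ 4 g (Set.Ioi 0))
    (hg_super : Tendsto (fun x => g x / x) atTop atTop)
    (hh_mono : ∃ x₀ : ℝ, StrictMonoOn (deriv g) (Set.Ioi x₀))
    (hh_top : Tendsto (deriv g) atTop atTop)
    (hψ_inv : ∀ᶠ t in atTop, deriv g (ψ t) = t)
    (hψ_inv' : ∀ᶠ x in atTop, ψ (deriv g x) = x)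
    (hψ_top : Tendsto ψ atTop atTop)
    (hcase : Case1 (deriv g) β c θ ε) :
    Tendsto (fun x => deriv (deriv g) x / (β * deriv g x / x)) atTop (nhds 1) ∧
    ∀ i : ℕ, i ∈ ({1, 2, 3} : Set ℕ) →
      ∃ C > (0:ℝ), ∀ᶠ x in atTop,
        |iteratedDeriv i (deriv g) x| ≤ C * deriv g x / x ^ i := by
  set h := deriv g with hh
  have hpos : ∀ᶠ x in atTop, 0 < h x := hh_top.eventually_gt_atTop 0
  have hD : ∀ x, 1 < x → HasDerivAt h (h x * (β + ε x) / x) x := fun x hx => hcase.hasDerivAt hx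
  have hε : ∀ x, 1 < x → HasDerivAt ε (deriv ε x) x :=
    fun x hx => (hcase.eps_diff x hx.le).hasDerivAt
  have hε' : ∀ x, 1 < x → HasDerivAt (deriv ε) (deriv (deriv ε) x) x :=
    fun x hx => (hcase.eps_diff2 x hx.le).hasDerivAt
  have h1 : ∀ x, 1 < x → deriv h x = h x * (β + ε x) / x ^ 1 := fun x hx => by
    rw [(hD x hx).deriv, pow_one]
  have h2 := deriv_eq_of_eq_mul_div_pow hD h1 (fun x hx => (hε x hx).const_add β)
  have h3 := deriv_eq_of_eq_mul_div_pow hD h2 (fun x hx =>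
    ((((hε x hx).const_add β).mul ((hε x hx).const_add β)).add
      ((hasDerivAt_id x).mul (hε' x hx))).sub (((hε x hx).const_add β).const_mul ((1 : ℕ) : ℝ)))
  have b1 : (fun x => β + ε x) =O[atTop] (fun _ => (1:ℝ)) :=
    (hcase.eps_to_zero.const_add β).isBigO_one ℝ
  have bd := hcase.eps_deriv_bigO
  have bdd := hcase.eps_deriv2_bigO
  have bmul : ∀ {u v : ℝ → ℝ}, u =O[atTop] (fun _ => (1:ℝ)) → v =O[atTop] (fun _ => (1:ℝ)) →
      (fun x => u x * v x) =O[atTop] (fun _ => (1:ℝ)) := fun hu hv => by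
    simpa using hu.mul hv
  have b2 : (fun x => (β + ε x) * (β + ε x) + x * deriv ε x - ((1 : ℕ) : ℝ) * (β + ε x))
      =O[atTop] (fun _ => (1:ℝ)) := ((bmul b1 b1).add bd).sub (b1.const_mul_left _)
  constructor
  · have hlim : Tendsto (fun x => (β + ε x) / β) atTop (nhds 1) := by
      simpa [hcase.beta_pos.ne'] using (hcase.eps_to_zero.const_add β).div_const β
    refine hlim.congr' ?_
    filter_upwards [hpos, eventually_gt_atTop 1] with x hx hx1
    have hx0 : x ≠ 0 := by linarith
    have hβ := hcase.beta_pos.ne'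
    rw [h1 x hx1]
    field_simp
  · rintro i (rfl | rfl | rfl)
    · rw [iteratedDeriv_one]
      exact exists_abs_le_of_eq_mul_div_pow hpos h1 b1
    · rw [iteratedDeriv_succ, iteratedDeriv_one]
      exact exists_abs_le_of_eq_mul_div_pow hpos h2 b2
    · rw [iteratedDeriv_succ, iteratedDeriv_succ, iteratedDeriv_one]
      refine exists_abs_le_of_eq_mul_div_pow hpos h3 ?_
      refine (((bmul b1 b2).add (((bmul b1 bd).const_mul_left 2).add bdd)).sub
        (b2.const_mul_left ((1 + 1 : ℕ) : ℝ))).congr_left fun x => ?_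
      push_cast
      simp only [id]
      ring
end
end

section
/- Assume Case 2 (the rapidly varying case) holds. Then ψ''(t) ~ −ψ(t)ε(t)/t² and ψ'''(t) ~ 2ψ(t)ε(t)/t³ as t → ∞. -/
open Real Filter MeasureTheory Set ProbabilityTheory Asymptotics

noncomputable section

/-- A bound `|f'| ≤ |f|` off the zeros of `f` extends to the zeros when `f'` is continuous. -/
lemma abs_deriv_le_of_ne_zero {f : ℝ → ℝ} {T : ℝ}
    (hd : ∀ t ≥ T, DifferentiableAt ℝ f t) (hc : ∀ t ≥ T, ContinuousAt (deriv f) t)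
    (hb : ∀ t ≥ T, f t ≠ 0 → |deriv f t| ≤ |f t|) {t : ℝ} (ht : T < t) :
    |deriv f t| ≤ |f t| := by
  by_cases h0 : f t = 0
  · by_cases h1 : deriv f t = 0
    · simp [h0, h1]
    have hne : ∀ᶠ x in nhdsWithin t {t}ᶜ, f x ≠ 0 :=
      (hd t ht.le).hasDerivAt.eventually_ne h1
    have hle : ∀ᶠ x in nhdsWithin t {t}ᶜ, |deriv f x| ≤ |f x| := by
      filter_upwards [hne, mem_nhdsWithin_of_mem_nhds (Ioi_mem_nhds ht)] with x hx hxT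
      exact hb x (le_of_lt hxT) hx
    exact le_of_tendsto_of_tendsto
      ((hc t ht.le).abs.tendsto.mono_left nhdsWithin_le_nhds)
      ((hd t ht.le).continuousAt.abs.tendsto.mono_left nhdsWithin_le_nhds) hle
  · exact hb t ht.le h0

/-- If `|f'| ≤ |f|` beyond `T`, then `f` vanishes after any of its zeros there. -/
lemma eq_zero_of_abs_deriv_le {f : ℝ → ℝ} {T : ℝ}
    (hd : ∀ t > T, DifferentiableAt ℝ f t) (hb : ∀ t > T, |deriv f t| ≤ |f t|)
    {a t : ℝ} (ha : T < a) (hfa : f a = 0) (hat : a ≤ t) : f t = 0 := by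
  have h := norm_le_gronwallBound_of_norm_deriv_right_le (f := f) (f' := deriv f)
    (δ := 0) (K := 1) (ε := 0) (a := a) (b := t)
    (fun x hx => (hd x (ha.trans_le hx.1)).continuousAt.continuousWithinAt)
    (fun x hx => (hd x (ha.trans_le hx.1)).hasDerivAt.hasDerivWithinAt)
    (by simp [hfa]) (fun x hx => by simpa using hb x (ha.trans_le hx.1))
    t (right_mem_Icc.2 hat)
  simpa [gronwallBound_ε0] using h

namespace Case2

variable {ψ : ℝ → ℝ} {c : ℝ} {ε : ℝ → ℝ}

lemma psi_pos (h : Case2 ψ c ε) {t : ℝ} (ht : 1 ≤ t) : 0 < ψ t := by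
  rw [h.psi_eq t ht]
  exact mul_pos h.c_pos (exp_pos _)

lemma continuousAt_eps_div (h : Case2 ψ c ε) {t : ℝ} (ht : 1 ≤ t) :
    ContinuousAt (fun u => ε u / u) t :=
  (h.eps_diff t ht).continuousAt.div continuousAt_id (by simp; linarith)

lemma intervalIntegrable (h : Case2 ψ c ε) {a b : ℝ} (ha : 1 ≤ a) (hb : 1 ≤ b) :
    IntervalIntegrable (fun u => ε u / u) volume a b :=
  ContinuousOn.intervalIntegrable fun _ hx =>
    (h.continuousAt_eps_div ((le_inf ha hb).trans hx.1)).continuousWithinAt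

lemma hasDerivAt_psi (h : Case2 ψ c ε) {t : ℝ} (ht : 1 < t) :
    HasDerivAt ψ (ψ t * ε t / t) t := by
  have hmeas : StronglyMeasurableAtFilter (fun u => ε u / u) (nhds t) volume :=
    ContinuousAt.stronglyMeasurableAtFilter isOpen_Ioi
      (fun x hx => h.continuousAt_eps_div (le_of_lt hx)) t (show t ∈ Ioi 1 from ht)
  have hI := intervalIntegral.integral_hasDerivAt_right
    (h.intervalIntegrable le_rfl ht.le) hmeas (h.continuousAt_eps_div ht.le)
  have hE := (hI.exp.const_mul c).congr_of_eventuallyEq (f₁ := ψ) (by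
    filter_upwards [Ioi_mem_nhds ht] with x hx
    exact h.psi_eq x (le_of_lt hx))
  have hval : ψ t * ε t / t = c * (exp (∫ u in (1:ℝ)..t, ε u / u) * (ε t / t)) := by
    rw [h.psi_eq t ht.le]
    ring
  exact hval ▸ hE

lemma iteratedDeriv_one (h : Case2 ψ c ε) {t : ℝ} (ht : 1 < t) :
    iteratedDeriv 1 ψ t = ψ t * ε t / t := by
  rw [_root_.iteratedDeriv_one, (h.hasDerivAt_psi ht).deriv]

lemma iteratedDeriv_two (h : Case2 ψ c ε) {t : ℝ} (ht : 1 < t) :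
    iteratedDeriv 2 ψ t = ψ t * (ε t ^ 2 + t * deriv ε t - ε t) / t ^ 2 := by
  have ht0 : t ≠ 0 := by linarith
  have hd := ((h.hasDerivAt_psi ht).mul (h.eps_diff t ht.le).hasDerivAt).div
    (hasDerivAt_id t) ht0
  rw [iteratedDeriv_succ]
  refine (hd.congr_of_eventuallyEq (f₁ := iteratedDeriv 1 ψ) ?_).deriv.trans ?_
  · filter_upwards [Ioi_mem_nhds ht] with x hx
    exact h.iteratedDeriv_one hx
  · simp only [id, Pi.mul_apply]
    field_simp

lemma iteratedDeriv_three (h : Case2 ψ c ε) {t : ℝ} (ht : 1 < t) :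
    iteratedDeriv 3 ψ t = ψ t * ((ε t - 2) * (ε t ^ 2 + t * deriv ε t - ε t)
      + 2 * ε t * (t * deriv ε t) + t ^ 2 * deriv (deriv ε) t) / t ^ 3 := by
  have ht0 : t ≠ 0 := by linarith
  have he := (h.eps_diff t ht.le).hasDerivAt
  have hd := ((h.hasDerivAt_psi ht).mul (((he.pow 2).add
    ((hasDerivAt_id t).mul (h.eps_diff2 t ht.le).hasDerivAt)).sub he)).div
    ((hasDerivAt_id t).pow 2) (pow_ne_zero 2 ht0)
  rw [iteratedDeriv_succ]
  refine (hd.congr_of_eventuallyEq (f₁ := iteratedDeriv 2 ψ) ?_).deriv.trans ?_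
  · filter_upwards [Ioi_mem_nhds ht] with x hx
    exact h.iteratedDeriv_two hx
  · simp only [id, Pi.mul_apply, Pi.add_apply, Pi.sub_apply, Pi.pow_apply]
    field_simp
    ring

/-- A zero of `ε` far out would make `ψ` eventually constant. -/
lemma eventually_eps_ne_zero (h : Case2 ψ c ε) (htop : Tendsto ψ atTop atTop) :
    ∀ᶠ t in atTop, ε t ≠ 0 := by
  have hsmall : ∀ᶠ t in atTop, |t * deriv ε t / ε t| < 1 := by
    simpa using h.eps_ratio1.abs.eventually_lt_const (by simp : |(0:ℝ)| < 1)
  obtain ⟨T, hT⟩ := eventually_atTop.1 (hsmall.and (eventually_ge_atTop 1))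
  have hb : ∀ t ≥ T, ε t ≠ 0 → |deriv ε t| ≤ |ε t| := by
    intro t ht h0
    obtain ⟨h1, h2⟩ := hT t ht
    rw [abs_div, div_lt_one (abs_pos.2 h0), abs_mul, abs_of_pos (by linarith)] at h1
    nlinarith [abs_nonneg (deriv ε t)]
  have hb' : ∀ t > T, |deriv ε t| ≤ |ε t| := fun t ht =>
    abs_deriv_le_of_ne_zero (fun s hs => h.eps_diff s (hT s hs).2)
      (fun s hs => (h.eps_diff2 s (hT s hs).2).continuousAt) hb ht
  filter_upwards [eventually_gt_atTop T] with a ha h0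
  have ha1 : 1 ≤ a := (hT a ha.le).2
  have hconst : ∀ t ≥ a, ψ t = ψ a := by
    intro t hat
    have hz : ∫ u in a..t, ε u / u = 0 := by
      rw [intervalIntegral.integral_congr (g := fun _ => 0), intervalIntegral.integral_zero]
      intro u hu
      rw [uIcc_of_le hat] at hu
      simp [eq_zero_of_abs_deriv_le (fun s hs => h.eps_diff s (hT s (le_of_lt hs)).2)
        hb' ha h0 hu.1]
    rw [h.psi_eq t (ha1.trans hat), h.psi_eq a ha1,
      ← intervalIntegral.integral_add_adjacent_intervals (h.intervalIntegrable le_rfl ha1)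
        (h.intervalIntegrable ha1 (ha1.trans hat)), hz, add_zero]
  obtain ⟨t, h1, h2⟩ := ((htop.eventually_gt_atTop (ψ a)).and (eventually_ge_atTop a)).exists
  exact h1.ne' (hconst t h2)

end Case2

/-- in Case 2, `ψ″(t) ~ −ψ(t)ε(t)/t²` and `ψ‴(t) ~ 2ψ(t)ε(t)/t³`
as `t → ∞`. -/
theorem case2_psi_derivs
    (g ψ : ℝ → ℝ) (c : ℝ) (ε : ℝ → ℝ)
    (hg_pos : ∀ x > (0:ℝ), 0 < g x)
    (hg_conv : ConvexOn ℝ (Set.Ioi 0) g)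
    (hg_smooth : ContDiffOn ℝ 4 g (Set.Ioi 0))
    (hg_super : Tendsto (fun x => g x / x) atTop atTop)
    (hh_mono : ∃ x₀ : ℝ, StrictMonoOn (deriv g) (Set.Ioi x₀))
    (hh_top : Tendsto (deriv g) atTop atTop)
    (hψ_inv : ∀ᶠ t in atTop, deriv g (ψ t) = t)
    (hψ_inv' : ∀ᶠ x in atTop, ψ (deriv g x) = x)
    (hψ_top : Tendsto ψ atTop atTop)
    (hcase : Case2 ψ c ε) :
    Tendsto (fun t => iteratedDeriv 2 ψ t / (-(ψ t * ε t) / t ^ 2)) atTop (nhds 1) ∧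
    Tendsto (fun t => iteratedDeriv 3 ψ t / (2 * ψ t * ε t / t ^ 3)) atTop (nhds 1) := by
  have hne := hcase.eventually_eps_ne_zero hψ_top
  have he := hcase.eps_to_zero
  have h1 := hcase.eps_ratio1
  have h2 := hcase.eps_ratio2
  constructor
  · have hlim : Tendsto (fun t => 1 - ε t - t * deriv ε t / ε t) atTop (nhds 1) := by
      simpa using (he.const_sub 1).sub h1
    refine hlim.congr' ?_
    filter_upwards [hne, eventually_gt_atTop 1] with t h0 ht
    have hψ := (hcase.psi_pos ht.le).ne'
    have ht0 : t ≠ 0 := by linarith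
    rw [hcase.iteratedDeriv_two ht]
    field_simp
    ring
  · have hlim : Tendsto (fun t => ((ε t - 2) * (ε t + t * deriv ε t / ε t - 1)
        + 2 * ε t * (t * deriv ε t / ε t) + t ^ 2 * deriv (deriv ε) t / ε t) / 2)
        atTop (nhds 1) := by
      have := (((((he.sub_const 2).mul ((he.add h1).sub_const 1)).add
        ((he.const_mul 2).mul h1)).add h2).div_const 2)
      norm_num at this
      exact this
    refine hlim.congr' ?_
    filter_upwards [hne, eventually_gt_atTop 1] with t h0 ht
    have hψ := (hcase.psi_pos ht.le).ne'
    have ht0 : t ≠ 0 := by linarith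
    rw [hcase.iteratedDeriv_three ht]
    field_simp
end
end

section
/- Assume Case 2 (the rapidly varying case) holds. Then h'(ψ(t)) = 1/ψ'(t) = t/(ψ(t)ε(t)) for all large t, h''(ψ(t)) = −ψ''(t)/(ψ'(t))³ ~ t/(ψ(t)²ε(t)²) as t → ∞, and h'''(ψ(t)) = (3(ψ''(t))² − ψ'''(t)ψ'(t))/(ψ'(t))⁵ ~ t/(ψ(t)³ε(t)³) as t → ∞. -/
open Real Filter MeasureTheory Set ProbabilityTheory Asymptotics

noncomputable section

/-- If a function agrees beyond `T` with one that is differentiable there, its derivative is the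
derivative of that function. -/
theorem HasDerivAt.congr_Ioi {f f₁ : ℝ → ℝ} {f' T t : ℝ} (hf : ∀ s > T, f s = f₁ s)
    (ht : T < t) (h : HasDerivAt f₁ f' t) : HasDerivAt f f' t :=
  h.congr_of_eventuallyEq ((eventually_gt_nhds ht).mono hf)

/-- If `F ∘ ψ = G` beyond `T`, then `F' (ψ t) = G' t / ψ' t` wherever `ψ' t ≠ 0`. -/
theorem deriv_at_comp_eq_div {F G ψ : ℝ → ℝ} {T t p q : ℝ} (h : ∀ s > T, F (ψ s) = G s)
    (ht : T < t) (hF : DifferentiableAt ℝ F (ψ t)) (hψ : HasDerivAt ψ p t)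
    (hG : HasDerivAt G q t) (hp : p ≠ 0) : deriv F (ψ t) = q / p := by
  have h1 : HasDerivAt (F ∘ ψ) (deriv F (ψ t) * p) t := hF.hasDerivAt.comp t hψ
  rw [eq_div_iff hp]
  exact h1.unique (HasDerivAt.congr_Ioi (f := F ∘ ψ) h ht hG)

/-- The derivatives up to order three of a left inverse `h` of `ψ`, evaluated at `ψ t`. -/
theorem iteratedDeriv_leftInverse {h ψ ψ₁ ψ₂ ψ₃ : ℝ → ℝ} {T : ℝ}
    (hh : ContDiffOn ℝ 3 h (Ioi 0)) (hpos : ∀ t > T, 0 < ψ t) (hinv : ∀ t > T, h (ψ t) = t)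
    (h₁ : ∀ t > T, HasDerivAt ψ (ψ₁ t) t) (h₂ : ∀ t > T, HasDerivAt ψ₁ (ψ₂ t) t)
    (h₃ : ∀ t > T, HasDerivAt ψ₂ (ψ₃ t) t) {t : ℝ} (ht : T < t) :
    ψ₁ t ≠ 0 ∧ deriv h (ψ t) = 1 / ψ₁ t ∧
      iteratedDeriv 2 h (ψ t) = -ψ₂ t / ψ₁ t ^ 3 ∧
      iteratedDeriv 3 h (ψ t) = (3 * ψ₂ t ^ 2 - ψ₃ t * ψ₁ t) / ψ₁ t ^ 5 := by
  have c1 : ContDiffOn ℝ 2 (deriv h) (Ioi 0) := hh.deriv_of_isOpen isOpen_Ioi (by norm_num)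
  have c2 : ContDiffOn ℝ 1 (deriv (deriv h)) (Ioi 0) :=
    c1.deriv_of_isOpen isOpen_Ioi (by norm_num)
  have diff {n : WithTop ℕ∞} {F : ℝ → ℝ} (hF : ContDiffOn ℝ n F (Ioi 0)) (hn : n ≠ 0)
      (s : ℝ) (hs : s > T) : DifferentiableAt ℝ F (ψ s) :=
    (hF.differentiableOn hn).differentiableAt (Ioi_mem_nhds (hpos s hs))
  have ne (s : ℝ) (hs : s > T) : ψ₁ s ≠ 0 := by
    intro h0
    have hc : HasDerivAt (h ∘ ψ) (deriv h (ψ s) * ψ₁ s) s :=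
      (diff hh (by norm_num) s hs).hasDerivAt.comp s (h₁ s hs)
    have := hc.unique (HasDerivAt.congr_Ioi (f := h ∘ ψ) hinv hs (hasDerivAt_id s))
    simp [h0] at this
  have e1 (s : ℝ) (hs : s > T) : deriv h (ψ s) = 1 / ψ₁ s :=
    deriv_at_comp_eq_div hinv hs (diff hh (by norm_num) s hs) (h₁ s hs) (hasDerivAt_id s)
      (ne s hs)
  have e2 (s : ℝ) (hs : s > T) : deriv (deriv h) (ψ s) = -ψ₂ s / ψ₁ s ^ 3 := by
    have n := ne s hs
    rw [deriv_at_comp_eq_div e1 hs (diff c1 (by norm_num) s hs) (h₁ s hs)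
      ((hasDerivAt_const s 1).fun_div (h₂ s hs) n) n]
    field_simp
    ring
  have e3 : deriv (deriv (deriv h)) (ψ t) = (3 * ψ₂ t ^ 2 - ψ₃ t * ψ₁ t) / ψ₁ t ^ 5 := by
    have n := ne t ht
    rw [deriv_at_comp_eq_div e2 ht (diff c2 (by norm_num) t ht) (h₁ t ht)
      ((h₃ t ht).fun_neg.fun_div ((h₂ t ht).fun_pow 3) (pow_ne_zero 3 n)) n]
    field_simp
    ring
  exact ⟨ne t ht, e1 t ht, by simpa [iteratedDeriv_succ] using e2 t ht,
    by simpa [iteratedDeriv_succ] using e3⟩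

theorem Case2.hasDerivAt {ψ ε : ℝ → ℝ} {c t : ℝ} (hcase : Case2 ψ c ε) (ht : 1 < t) :
    HasDerivAt ψ (ψ t * ε t / t) t := by
  have hc : ContinuousOn (fun u => ε u / u) (Ici 1) := fun u hu =>
    ((hcase.eps_diff u hu).continuousAt.div continuousAt_id
      (zero_lt_one.trans_le hu).ne').continuousWithinAt
  have hint : HasDerivAt (fun x => ∫ u in (1:ℝ)..x, ε u / u) (ε t / t) t :=
    intervalIntegral.integral_hasDerivAt_right
      ((hc.mono (by rw [uIcc_of_le ht.le]; exact Icc_subset_Ici_self)).intervalIntegrable)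
      ((hc.mono Ioi_subset_Ici_self).stronglyMeasurableAtFilter isOpen_Ioi t ht)
      (hc.continuousAt (Ici_mem_nhds ht))
  have h := HasDerivAt.congr_Ioi (fun s hs => hcase.psi_eq s (le_of_lt hs)) ht
    (hint.exp.const_mul c)
  rw [hcase.psi_eq t ht.le]
  exact h.congr_deriv (by ring)

/-- in Case 2, `h′(ψ(t)) = 1/ψ′(t) = t/(ψ(t)ε(t))` for all large `t`,
`h″(ψ(t)) = −ψ″(t)/ψ′(t)³ ~ t/(ψ(t)²ε(t)²)`, and
`h‴(ψ(t)) = (3ψ″(t)² − ψ‴(t)ψ′(t))/ψ′(t)⁵ ~ t/(ψ(t)³ε(t)³)` as `t → ∞`. -/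
theorem case2_h_derivs_at_psi
    (g ψ : ℝ → ℝ) (c : ℝ) (ε : ℝ → ℝ)
    (hg_pos : ∀ x > (0:ℝ), 0 < g x)
    (hg_conv : ConvexOn ℝ (Set.Ioi 0) g)
    (hg_smooth : ContDiffOn ℝ 4 g (Set.Ioi 0))
    (hg_super : Tendsto (fun x => g x / x) atTop atTop)
    (hh_mono : ∃ x₀ : ℝ, StrictMonoOn (deriv g) (Set.Ioi x₀))
    (hh_top : Tendsto (deriv g) atTop atTop)
    (hψ_inv : ∀ᶠ t in atTop, deriv g (ψ t) = t)
    (hψ_inv' : ∀ᶠ x in atTop, ψ (deriv g x) = x)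
    (hψ_top : Tendsto ψ atTop atTop)
    (hcase : Case2 ψ c ε) :
    (∀ᶠ t in atTop, deriv (deriv g) (ψ t) = 1 / deriv ψ t ∧
        1 / deriv ψ t = t / (ψ t * ε t)) ∧
    (∀ᶠ t in atTop,
        iteratedDeriv 2 (deriv g) (ψ t) = -iteratedDeriv 2 ψ t / (deriv ψ t) ^ 3) ∧
    Tendsto (fun t => iteratedDeriv 2 (deriv g) (ψ t) / (t / (ψ t ^ 2 * ε t ^ 2)))
      atTop (nhds 1) ∧
    (∀ᶠ t in atTop,
        iteratedDeriv 3 (deriv g) (ψ t) =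
          (3 * (iteratedDeriv 2 ψ t) ^ 2 - iteratedDeriv 3 ψ t * deriv ψ t) /
            (deriv ψ t) ^ 5) ∧
    Tendsto (fun t => iteratedDeriv 3 (deriv g) (ψ t) / (t / (ψ t ^ 3 * ε t ^ 3)))
      atTop (nhds 1) := by
  obtain ⟨T, hT⟩ := eventually_atTop.1
    (((hψ_inv.and (hψ_top.eventually_gt_atTop 0)).and (eventually_gt_atTop (1:ℝ))))
  have hh : ContDiffOn ℝ 3 (deriv g) (Ioi 0) :=
    hg_smooth.deriv_of_isOpen isOpen_Ioi (by norm_num)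
  have one_lt (t : ℝ) (ht : t > T) : 1 < t := (hT t ht.le).2
  have ne0 (t : ℝ) (ht : t > T) : t ≠ 0 := (zero_lt_one.trans (one_lt t ht)).ne'
  have hpos (t : ℝ) (ht : t > T) : 0 < ψ t := (hT t ht.le).1.2
  have h₁ (t : ℝ) (ht : t > T) : HasDerivAt ψ (ψ t * ε t / t) t :=
    hcase.hasDerivAt (one_lt t ht)
  have hε (t : ℝ) (ht : t > T) : HasDerivAt ε (deriv ε t) t :=
    (hcase.eps_diff t (one_lt t ht).le).hasDerivAt
  have hε' (t : ℝ) (ht : t > T) : HasDerivAt (deriv ε) (deriv (deriv ε) t) t :=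
    (hcase.eps_diff2 t (one_lt t ht).le).hasDerivAt
  have h₂ (t : ℝ) (ht : t > T) : HasDerivAt (fun t => ψ t * ε t / t)
      (ψ t * (ε t ^ 2 + t * deriv ε t - ε t) / t ^ 2) t := by
    have n := ne0 t ht
    refine (((h₁ t ht).fun_mul (hε t ht)).fun_div (hasDerivAt_id' t) n).congr_deriv ?_
    field_simp
  have h₃ (t : ℝ) (ht : t > T) : HasDerivAt
      (fun t => ψ t * (ε t ^ 2 + t * deriv ε t - ε t) / t ^ 2)
      (ψ t * ((ε t - 2) * (ε t ^ 2 + t * deriv ε t - ε t) + 2 * t * ε t * deriv ε t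
        + t ^ 2 * deriv (deriv ε) t) / t ^ 3) t := by
    have n := ne0 t ht
    refine (((h₁ t ht).fun_mul ((((hε t ht).fun_pow 2).fun_add
      ((hasDerivAt_id' t).fun_mul (hε' t ht))).fun_sub (hε t ht))).fun_div
      ((hasDerivAt_id' t).fun_pow 2) (pow_ne_zero 2 n)).congr_deriv ?_
    field_simp
    ring
  have key (t : ℝ) (ht : t > T) := iteratedDeriv_leftInverse hh hpos (fun s hs => (hT s hs.le).1.1)
    h₁ h₂ h₃ ht
  have d1 (t : ℝ) (ht : t > T) : deriv ψ t = ψ t * ε t / t := (h₁ t ht).deriv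
  have d2 (t : ℝ) (ht : t > T) : iteratedDeriv 2 ψ t =
      ψ t * (ε t ^ 2 + t * deriv ε t - ε t) / t ^ 2 := by
    rw [iteratedDeriv_succ, iteratedDeriv_one]
    exact (HasDerivAt.congr_Ioi d1 ht (h₂ t ht)).deriv
  have d3 (t : ℝ) (ht : t > T) : iteratedDeriv 3 ψ t =
      ψ t * ((ε t - 2) * (ε t ^ 2 + t * deriv ε t - ε t) + 2 * t * ε t * deriv ε t
        + t ^ 2 * deriv (deriv ε) t) / t ^ 3 := by
    rw [iteratedDeriv_succ]
    exact (HasDerivAt.congr_Ioi d2 ht (h₃ t ht)).deriv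
  have εne (t : ℝ) (ht : t > T) : ε t ≠ 0 := fun h => (key t ht).1 (by simp [h])
  have l0 := hcase.eps_to_zero
  have la := hcase.eps_ratio1
  have lb := hcase.eps_ratio2
  have lA := (l0.add la).sub_const 1
  refine ⟨?_, ?_, ?_, ?_, ?_⟩
  · filter_upwards [eventually_gt_atTop T] with t ht
    rw [d1 t ht]
    exact ⟨(key t ht).2.1, one_div_div _ _⟩
  · filter_upwards [eventually_gt_atTop T] with t ht
    rw [d1 t ht, d2 t ht]
    exact (key t ht).2.2.1
  · have lim := lA.neg
    norm_num at lim
    refine lim.congr' ?_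
    filter_upwards [eventually_gt_atTop T] with t ht
    rw [(key t ht).2.2.1]
    have := ne0 t ht
    have := εne t ht
    have := (hpos t ht).ne'
    field_simp
    ring
  · filter_upwards [eventually_gt_atTop T] with t ht
    rw [d1 t ht, d2 t ht, d3 t ht]
    exact (key t ht).2.2.2
  · have lim := ((lA.pow 2).const_mul 3).sub
      ((((l0.sub_const 2).mul lA).add ((la.mul l0).const_mul 2)).add lb)
    norm_num at lim
    refine lim.congr' ?_
    filter_upwards [eventually_gt_atTop T] with t ht
    rw [(key t ht).2.2.2]
    have := ne0 t ht
    have := εne t ht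
    have := (hpos t ht).ne'
    field_simp
end
end
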